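/- Let σ = 1 and μ = 0, and let (u, ρ) be a classical solution of the R2CH system on [0,T) such that ‖ρ(t,·)‖_{L^∞} ≤ M̄ for all t ∈ [0,T), with E(0) > 0. Set m₀ = ∫_ℝ (∂_x u₀(x))³ dx and let N = N(M̄) be the constant defined in the context. If m₀ < −√(2 E(0) N), then T ≤ √(E(0)/(2N)) · ln( (m₀ − √(2E(0)N)) / (m₀ + √(2E(0)N)) ). (Theorem 4.2: blow-up under a negativity condition on ∫(∂_x u₀)³) -/

import Mathlib

open Set Filter MeasureTheory Topology Real

/-- A classical solution of the rotation-two-component Camassa–Holm (R2CH) system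
on `[0,T) × ℝ`:  `u` has continuous spatial derivatives up to order three and a
continuous time derivative (also of `∂ₓ²u`), `ρ` has a continuous spatial
derivative and a continuous time derivative, both equations hold pointwise,
`u(t,·), ∂ₓu(t,·), ∂ₓ²u(t,·), ρ(t,·)-1, ∂ₓρ(t,·)` are square integrable,
`ρ(t,·)-1` is bounded and `u → 0`, `∂ₓu → 0`, `ρ → 1` as `|x| → ∞`. -/
structure R2CHSolution (A μ σ Ω T : ℝ) (u ρ : ℝ → ℝ → ℝ) : Prop where
  T_pos : 0 < T
  u_smooth : ∀ t ∈ Ico (0:ℝ) T, ContDiff ℝ 3 (u t)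
  ρ_smooth : ∀ t ∈ Ico (0:ℝ) T, ContDiff ℝ 1 (ρ t)
  u_jcont : ∀ k : ℕ, k ≤ 3 →
    ContinuousOn (fun p : ℝ × ℝ => iteratedDeriv k (u p.1) p.2) (Ico 0 T ×ˢ (univ : Set ℝ))
  ρ_jcont : ∀ k : ℕ, k ≤ 1 →
    ContinuousOn (fun p : ℝ × ℝ => iteratedDeriv k (ρ p.1) p.2) (Ico 0 T ×ˢ (univ : Set ℝ))
  u_tdiff : ∀ x : ℝ, ∀ t ∈ Ico (0:ℝ) T,
    DifferentiableWithinAt ℝ (fun s => u s x) (Ico 0 T) t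
  uxx_tdiff : ∀ x : ℝ, ∀ t ∈ Ico (0:ℝ) T,
    DifferentiableWithinAt ℝ (fun s => deriv (deriv (u s)) x) (Ico 0 T) t
  ρ_tdiff : ∀ x : ℝ, ∀ t ∈ Ico (0:ℝ) T,
    DifferentiableWithinAt ℝ (fun s => ρ s x) (Ico 0 T) t
  ut_jcont : ContinuousOn
    (fun p : ℝ × ℝ => derivWithin (fun s => u s p.2) (Ico 0 T) p.1) (Ico 0 T ×ˢ (univ : Set ℝ))
  utxx_jcont : ContinuousOn
    (fun p : ℝ × ℝ => derivWithin (fun s => deriv (deriv (u s)) p.2) (Ico 0 T) p.1)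
    (Ico 0 T ×ˢ (univ : Set ℝ))
  ρt_jcont : ContinuousOn
    (fun p : ℝ × ℝ => derivWithin (fun s => ρ s p.2) (Ico 0 T) p.1) (Ico 0 T ×ˢ (univ : Set ℝ))
  eq_u : ∀ t ∈ Ico (0:ℝ) T, ∀ x : ℝ,
    derivWithin (fun s => u s x) (Ico 0 T) t
      - derivWithin (fun s => deriv (deriv (u s)) x) (Ico 0 T) t
      - A * deriv (u t) x + 3 * u t x * deriv (u t) x
    = σ * (2 * deriv (u t) x * deriv (deriv (u t)) x
            + u t x * deriv (deriv (deriv (u t))) x)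
      - μ * deriv (deriv (deriv (u t))) x
      - (1 - 2 * Ω * A) * ρ t x * deriv (ρ t) x
      + 2 * Ω * ρ t x * deriv (fun y => ρ t y * u t y) x
  eq_ρ : ∀ t ∈ Ico (0:ℝ) T, ∀ x : ℝ,
    derivWithin (fun s => ρ s x) (Ico 0 T) t + deriv (fun y => u t y * ρ t y) x = 0
  u_L2 : ∀ t ∈ Ico (0:ℝ) T, Integrable (fun x => (u t x) ^ 2)
  ux_L2 : ∀ t ∈ Ico (0:ℝ) T, Integrable (fun x => (deriv (u t) x) ^ 2)
  uxx_L2 : ∀ t ∈ Ico (0:ℝ) T, Integrable (fun x => (deriv (deriv (u t)) x) ^ 2)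
  ρm1_L2 : ∀ t ∈ Ico (0:ℝ) T, Integrable (fun x => (ρ t x - 1) ^ 2)
  ρx_L2 : ∀ t ∈ Ico (0:ℝ) T, Integrable (fun x => (deriv (ρ t) x) ^ 2)
  ρm1_Linf : ∀ t ∈ Ico (0:ℝ) T, ∃ B : ℝ, ∀ x : ℝ, |ρ t x - 1| ≤ B
  u_decay : ∀ t ∈ Ico (0:ℝ) T, Tendsto (u t) (cocompact ℝ) (𝓝 0)
  ux_decay : ∀ t ∈ Ico (0:ℝ) T, Tendsto (deriv (u t)) (cocompact ℝ) (𝓝 0)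
  ρ_decay : ∀ t ∈ Ico (0:ℝ) T, Tendsto (ρ t) (cocompact ℝ) (𝓝 1)

/-- The energy `E(t) = ∫ (u² + uₓ² + (1-2ΩA)(ρ-1)²) dx`. -/
noncomputable def energy (Ω A : ℝ) (u ρ : ℝ → ℝ → ℝ) (t : ℝ) : ℝ :=
  ∫ x : ℝ, ((u t x) ^ 2 + (deriv (u t) x) ^ 2 + (1 - 2 * Ω * A) * (ρ t x - 1) ^ 2)

/-- The constant `N(M̄)` from Theorem 4.2, with `E = E(0)`. -/
noncomputable def Nconst (A Ω M E : ℝ) : ℝ :=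
  (3 * M ^ 2 * (1 - 2 * Ω * A) / 2 + 9 / 4) * E
    + (3 * Real.sqrt 2 * Ω * M ^ 2 / 2) * (E * Real.sqrt E)
    + (3 * Real.sqrt 2 * Ω / (4 * (1 - 2 * Ω * A))) * (E ^ 2 * Real.sqrt E)
    + ((6 + 3 * A ^ 2 + 6 * Ω ^ 2) / 4
        + 3 * Real.sqrt 2 * Ω / (2 * Real.sqrt (1 - 2 * Ω * A))
        + 3 * Ω * (1 - Ω * A) * (M + 1) / (2 * (1 - 2 * Ω * A))) * E ^ 2

theorem continuousOn_intervalIntegral_param {X : Type*} [TopologicalSpace X]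
    [FirstCountableTopology X] {F : X → ℝ → ℝ} {s : Set X}
    (hF : ContinuousOn (fun p : X × ℝ => F p.1 p.2) (s ×ˢ univ)) (c d : ℝ) :
    ContinuousOn (fun t => ∫ x in c..d, F t x) s := by
  rw [continuousOn_iff_continuous_domRestrict]
  have h : Continuous (Function.uncurry fun (t : s) (x : ℝ) => F t x) := by
    have h2 : Continuous fun q : s × ℝ => ((q.1 : X), q.2) := by fun_prop
    exact hF.comp_continuous h2 fun q => ⟨q.1.2, mem_univ _⟩
  exact intervalIntegral.continuous_parametric_intervalIntegral_of_continuous' h c d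

theorem continuous_slice {X : Type*} [TopologicalSpace X] {F : X → ℝ → ℝ} {s : Set X}
    (hF : ContinuousOn (fun p : X × ℝ => F p.1 p.2) (s ×ˢ univ)) {t : X} (ht : t ∈ s) :
    Continuous (F t) :=
  hF.comp_continuous (f := fun x : ℝ => (t, x)) (by fun_prop) fun _ => ⟨ht, mem_univ _⟩

theorem hasDerivAt_intervalIntegral_param {F F' : ℝ → ℝ → ℝ} {s : Set ℝ} (hs : IsOpen s)
    (hF : ∀ t ∈ s, Continuous (F t))
    (hF' : ContinuousOn (fun p : ℝ × ℝ => F' p.1 p.2) (s ×ˢ univ))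
    (hd : ∀ t ∈ s, ∀ x, HasDerivAt (fun τ => F τ x) (F' t x) t) {t : ℝ} (ht : t ∈ s) (c d : ℝ) :
    HasDerivAt (fun τ => ∫ x in c..d, F τ x) (∫ x in c..d, F' t x) t := by
  obtain ⟨k, hkc, htk, hks⟩ := exists_compact_subset hs ht
  have hcomp : IsCompact (k ×ˢ uIcc c d) := hkc.prod isCompact_uIcc
  obtain ⟨C, hC⟩ := hcomp.exists_bound_of_continuousOn
    (hF'.mono (prod_mono hks (subset_univ _)))
  refine (intervalIntegral.hasDerivAt_integral_of_dominated_loc_of_deriv_le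
    (bound := fun _ => C) (mem_interior_iff_mem_nhds.1 htk) ?_ ?_ ?_ ?_ ?_ ?_).2
  · filter_upwards [hs.mem_nhds ht] with τ hτ using (hF τ hτ).aestronglyMeasurable
  · exact (hF t ht).intervalIntegrable _ _
  · exact (continuous_slice hF' ht).aestronglyMeasurable
  · exact ae_of_all _ fun x hx τ hτ => hC (τ, x) ⟨hτ, uIoc_subset_uIcc hx⟩
  · exact intervalIntegrable_const
  · exact ae_of_all _ fun x _ τ hτ => hd τ (hks hτ) x

theorem hasDerivAt_max_zero_sq (s : ℝ) :
    HasDerivAt (fun s : ℝ => max 0 s ^ 2) (2 * max 0 s) s := by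
  rcases lt_trichotomy s 0 with h | h | h
  · rw [max_eq_left h.le, mul_zero]
    refine (hasDerivAt_const s (0 : ℝ)).congr_of_eventuallyEq ?_
    filter_upwards [Iio_mem_nhds h] with x hx
    simp [max_eq_left (le_of_lt (mem_Iio.1 hx))]
  · subst h
    rw [hasDerivAt_iff_isLittleO_nhds_zero]
    simp only [zero_add, max_self, mul_zero, smul_zero, sub_zero, ne_eq, OfNat.ofNat_ne_zero,
      not_false_eq_true, zero_pow]
    refine Asymptotics.IsBigO.trans_isLittleO (g := fun h : ℝ => h ^ 2) ?_ ?_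
    · refine Asymptotics.IsBigO.of_bound 1 (Eventually.of_forall fun x => ?_)
      rw [one_mul, Real.norm_eq_abs, Real.norm_eq_abs, abs_of_nonneg (sq_nonneg _),
        abs_of_nonneg (sq_nonneg _)]
      rcases le_total 0 x with hx | hx
      · rw [max_eq_right hx]
      · rw [max_eq_left hx]; nlinarith [sq_nonneg x]
    · simpa using Asymptotics.isLittleO_pow_id (𝕜 := ℝ) (n := 2) (by norm_num)
  · rw [max_eq_right h.le]
    have h2 := hasDerivAt_pow 2 s
    simp only [Nat.cast_ofNat, Nat.add_one_sub_one, pow_one] at h2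
    refine h2.congr_of_eventuallyEq ?_
    filter_upwards [Ioi_mem_nhds h] with x hx
    simp [max_eq_right (le_of_lt (mem_Ioi.1 hx))]

/-- A `C¹` cutoff function, supported in `[-R, R]` and increasing to `1` as `R → ∞`. -/
noncomputable def cutoff (R x : ℝ) : ℝ := max 0 (1 - (x / R) ^ 2) ^ 2

/-- The derivative of `cutoff R`. -/
noncomputable def cutoffDeriv (R x : ℝ) : ℝ := 2 * max 0 (1 - (x / R) ^ 2) * (-(2 * x / R ^ 2))

theorem hasDerivAt_cutoff (R x : ℝ) : HasDerivAt (cutoff R) (cutoffDeriv R x) x := by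
  have h1 : HasDerivAt (fun x : ℝ => 1 - (x / R) ^ 2) (-(2 * x / R ^ 2)) x := by
    refine ((((hasDerivAt_id' x).div_const R).fun_pow 2).const_sub 1).congr_deriv ?_
    by_cases hR : R = 0
    · simp [hR]
    · simp; field_simp
  exact (hasDerivAt_max_zero_sq _).comp x h1

theorem continuous_cutoff (R : ℝ) : Continuous (cutoff R) := by
  unfold cutoff; fun_prop

theorem continuous_cutoffDeriv (R : ℝ) : Continuous (cutoffDeriv R) := by
  unfold cutoffDeriv; fun_prop

theorem cutoff_nonneg (R x : ℝ) : 0 ≤ cutoff R x := sq_nonneg _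

theorem cutoff_le_one (R x : ℝ) : cutoff R x ≤ 1 := by
  unfold cutoff
  have h0 : 0 ≤ max 0 (1 - (x / R) ^ 2) := le_max_left _ _
  have h1 : max 0 (1 - (x / R) ^ 2) ≤ 1 := max_le zero_le_one (by nlinarith [sq_nonneg (x / R)])
  nlinarith

theorem cutoff_eq_zero {R x : ℝ} (hR : 0 < R) (hx : R ≤ |x|) : cutoff R x = 0 := by
  have h : 1 ≤ |x / R| := by rw [abs_div, abs_of_pos hR, le_div_iff₀ hR]; linarith
  have h2 : 1 ≤ (x / R) ^ 2 := by rw [← sq_abs]; nlinarith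
  unfold cutoff
  rw [max_eq_left (by linarith)]; norm_num

theorem cutoff_pos {R x : ℝ} (hR : 0 < R) (hx : |x| < R) : 0 < cutoff R x := by
  have h : |x / R| < 1 := by rw [abs_div, abs_of_pos hR, div_lt_one hR]; exact hx
  have h2 : (x / R) ^ 2 < 1 := by rw [← sq_abs]; nlinarith [abs_nonneg (x / R)]
  unfold cutoff
  have : 0 < max 0 (1 - (x / R) ^ 2) := lt_max_of_lt_right (sub_pos.2 h2)
  positivity

/-- The derivative of the cutoff is dominated by its square root. -/
theorem cutoffDeriv_sq_le {R : ℝ} (hR : 0 < R) (x : ℝ) :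
    cutoffDeriv R x ^ 2 ≤ (4 / R) ^ 2 * cutoff R x := by
  unfold cutoffDeriv cutoff
  rcases le_total R |x| with h | h
  · have h1 : 1 ≤ |x / R| := by rw [abs_div, abs_of_pos hR, le_div_iff₀ hR]; linarith
    have h2 : 1 ≤ (x / R) ^ 2 := by rw [← sq_abs]; nlinarith
    rw [max_eq_left (by linarith)]; norm_num
  · have h1 : x ^ 2 ≤ R ^ 2 := by rw [← sq_abs]; exact pow_le_pow_left₀ (abs_nonneg _) h 2
    have h2 : (2 * x / R ^ 2) ^ 2 ≤ (2 / R) ^ 2 := by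
      rw [div_pow, div_pow, div_le_div_iff₀ (by positivity) (by positivity)]
      nlinarith [mul_le_mul_of_nonneg_right h1 (sq_nonneg R)]
    have h3 : (4 / R) ^ 2 = 4 * (2 / R) ^ 2 := by field_simp; norm_num
    rw [h3]
    calc _ = 4 * (2 * x / R ^ 2) ^ 2 * max 0 (1 - (x / R) ^ 2) ^ 2 := by ring
      _ ≤ _ := by gcongr

theorem abs_cutoffDeriv_le {R : ℝ} (hR : 0 < R) (x : ℝ) : |cutoffDeriv R x| ≤ 4 / R := by
  refine abs_le_of_sq_le_sq ?_ (by positivity)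
  calc _ ≤ _ := cutoffDeriv_sq_le hR x
    _ ≤ (4 / R) ^ 2 * 1 := by gcongr; exact cutoff_le_one R x
    _ = _ := mul_one _

theorem tendsto_cutoff (x : ℝ) : Tendsto (fun R => cutoff R x) atTop (𝓝 1) := by
  unfold cutoff
  have h : Tendsto (fun R : ℝ => x / R) atTop (𝓝 0) := tendsto_id.const_div_atTop x
  have h2 := ((tendsto_const_nhds (x := (0 : ℝ))).max ((h.pow 2).const_sub 1)).pow 2
  simpa using h2

theorem integral_cutoff_mul_deriv {R : ℝ} (hR : 0 < R) {g g' : ℝ → ℝ}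
    (hg : ∀ x, HasDerivAt g (g' x) x) (hg' : Continuous g') :
    ∫ x in (-R)..R, cutoff R x * g' x = -∫ x in (-R)..R, cutoffDeriv R x * g x := by
  rw [intervalIntegral.integral_mul_deriv_eq_deriv_mul (fun x _ => hasDerivAt_cutoff R x)
    (fun x _ => hg x) ((continuous_cutoffDeriv R).intervalIntegrable _ _)
    (hg'.intervalIntegrable _ _), cutoff_eq_zero hR (by rw [abs_of_pos hR]),
    cutoff_eq_zero hR (by rw [abs_neg, abs_of_pos hR])]
  ring

theorem integral_cutoff_mul_le {R : ℝ} (hR : 0 < R) {g : ℝ → ℝ} (hg : Continuous g)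
    (h0 : ∀ x, 0 ≤ g x) (hi : Integrable g) : ∫ x in (-R)..R, cutoff R x * g x ≤ ∫ x, g x := by
  rw [intervalIntegral.integral_of_le (by linarith)]
  refine (setIntegral_mono ?_ hi.integrableOn fun x => ?_).trans
    (setIntegral_le_integral hi (ae_of_all _ h0))
  · exact (((continuous_cutoff R).mul hg).intervalIntegrable (-R) R).1
  · exact mul_le_of_le_one_left (h0 x) (cutoff_le_one R x)

theorem intervalIntegral_le_integral {a b : ℝ} (hab : a ≤ b) {g : ℝ → ℝ}
    (h0 : ∀ x, 0 ≤ g x) (hi : Integrable g) : ∫ x in a..b, g x ≤ ∫ x, g x := by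
  rw [intervalIntegral.integral_of_le hab]
  exact setIntegral_le_integral hi (ae_of_all _ h0)

theorem tendsto_integral_cutoff_mul {g : ℝ → ℝ} (hi : Integrable g) :
    Tendsto (fun R => ∫ x in (-R)..R, cutoff R x * g x) atTop (𝓝 (∫ x, g x)) := by
  have h : Tendsto (fun R => ∫ x, cutoff R x * g x) atTop (𝓝 (∫ x, g x)) := by
    refine tendsto_integral_filter_of_dominated_convergence (fun x => ‖g x‖) ?_ ?_ hi.norm ?_
    · exact Eventually.of_forall fun R =>
        (continuous_cutoff R).aestronglyMeasurable.mul hi.aestronglyMeasurable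
    · refine Eventually.of_forall fun R => ae_of_all _ fun x => ?_
      rw [norm_mul, Real.norm_of_nonneg (cutoff_nonneg R x)]
      exact mul_le_of_le_one_left (norm_nonneg _) (cutoff_le_one R x)
    · exact ae_of_all _ fun x => by simpa using (tendsto_cutoff x).mul_const (g x)
  refine h.congr' ?_
  filter_upwards [eventually_gt_atTop 0] with R hR
  rw [intervalIntegral.integral_of_le (by linarith)]
  symm
  apply setIntegral_eq_integral_of_forall_compl_eq_zero
  intro x hx
  rw [cutoff_eq_zero hR, zero_mul]
  by_contra! hlt
  rw [abs_lt] at hlt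
  exact hx ⟨hlt.1, hlt.2.le⟩

theorem integrableOn_exp_sub_Iic {c : ℝ} (hc : 0 < c) (x : ℝ) :
    IntegrableOn (fun y => exp (c * (y - x))) (Iic x) := by
  have h := (integrableOn_exp_mul_Iic hc x).const_mul (exp (-(c * x)))
  refine h.congr (ae_of_all _ fun y => ?_)
  simp only [← exp_add]
  congr 1; ring

theorem integral_exp_sub_Iic {c : ℝ} (hc : 0 < c) (x : ℝ) :
    ∫ y in Iic x, exp (c * (y - x)) = 1 / c := by
  have h : ∀ y, exp (c * (y - x)) = exp (-(c * x)) * exp (c * y) := fun y => by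
    rw [← exp_add]; congr 1; ring
  simp only [h]
  rw [integral_const_mul, integral_exp_mul_Iic hc, ← mul_div_assoc, ← exp_add]
  simp

theorem integrableOn_exp_sub_Ioi {c : ℝ} (hc : 0 < c) (x : ℝ) :
    IntegrableOn (fun y => exp (c * (x - y))) (Ioi x) := by
  have h := (integrableOn_exp_mul_Ioi (neg_lt_zero.2 hc) x).const_mul (exp (c * x))
  refine h.congr (ae_of_all _ fun y => ?_)
  simp only [← exp_add]
  congr 1; ring

theorem integral_exp_sub_Ioi {c : ℝ} (hc : 0 < c) (x : ℝ) :
    ∫ y in Ioi x, exp (c * (x - y)) = 1 / c := by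
  have h : ∀ y, exp (c * (x - y)) = exp (c * x) * exp (-c * y) := fun y => by
    rw [← exp_add]; congr 1; ring
  simp only [h]
  rw [integral_const_mul, integral_exp_mul_Ioi (neg_lt_zero.2 hc), ← mul_div_assoc, mul_neg,
    ← exp_add]
  simp

/-- The exponential average of `g` over the half-line to the left of `x`. -/
noncomputable def expLeft (g : ℝ → ℝ) (x : ℝ) : ℝ := ∫ y in Iic x, exp (y - x) * g y

/-- The exponential average of `g` over the half-line to the right of `x`. -/
noncomputable def expRight (g : ℝ → ℝ) (x : ℝ) : ℝ := ∫ y in Ioi x, exp (x - y) * g y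

section ExpAverage

variable {g G : ℝ → ℝ} {C : ℝ}

theorem integrableOn_expLeft (hg : Continuous g) (hb : ∀ y, |g y| ≤ C + G y)
    (hG0 : ∀ y, 0 ≤ G y) (hG : Integrable G) (x : ℝ) :
    IntegrableOn (fun y => exp (y - x) * g y) (Iic x) := by
  have h1 := (integrableOn_exp_sub_Iic one_pos x).const_mul C
  refine (h1.add hG.integrableOn).mono'
    (Continuous.aestronglyMeasurable (by fun_prop)) ?_
  refine (ae_restrict_iff' measurableSet_Iic).2 (ae_of_all _ fun y hy => ?_)
  have h2 : exp (y - x) ≤ 1 := exp_le_one_iff.2 (sub_nonpos.2 hy)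
  simp only [norm_mul, Real.norm_eq_abs, abs_exp, Pi.add_apply, one_mul]
  nlinarith [hb y, hG0 y, exp_pos (y - x), mul_le_mul_of_nonneg_left (hb y) (exp_pos (y - x)).le,
    mul_le_mul_of_nonneg_right h2 (hG0 y)]

theorem integrableOn_expRight (hg : Continuous g) (hb : ∀ y, |g y| ≤ C + G y)
    (hG0 : ∀ y, 0 ≤ G y) (hG : Integrable G) (x : ℝ) :
    IntegrableOn (fun y => exp (x - y) * g y) (Ioi x) := by
  have h1 := (integrableOn_exp_sub_Ioi one_pos x).const_mul C
  refine (h1.add hG.integrableOn).mono'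
    (Continuous.aestronglyMeasurable (by fun_prop)) ?_
  refine (ae_restrict_iff' measurableSet_Ioi).2 (ae_of_all _ fun y hy => ?_)
  have h2 : exp (x - y) ≤ 1 := exp_le_one_iff.2 (sub_nonpos.2 (mem_Ioi.1 hy).le)
  simp only [norm_mul, Real.norm_eq_abs, abs_exp, Pi.add_apply, one_mul]
  nlinarith [hb y, hG0 y, exp_pos (x - y), mul_le_mul_of_nonneg_left (hb y) (exp_pos (x - y)).le,
    mul_le_mul_of_nonneg_right h2 (hG0 y)]

theorem abs_expLeft_le (hb : ∀ y, |g y| ≤ C + G y)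
    (hG0 : ∀ y, 0 ≤ G y) (hG : Integrable G) (x : ℝ) : |expLeft g x| ≤ C + ∫ y, G y := by
  have h1 := (integrableOn_exp_sub_Iic one_pos x).const_mul C
  have h3 : |expLeft g x| ≤ ∫ y in Iic x, (C * exp (1 * (y - x)) + G y) := by
    rw [← Real.norm_eq_abs, expLeft]
    refine norm_integral_le_of_norm_le (h1.add hG.integrableOn) ?_
    refine (ae_restrict_iff' measurableSet_Iic).2 (ae_of_all _ fun y hy => ?_)
    have h2 : exp (y - x) ≤ 1 := exp_le_one_iff.2 (sub_nonpos.2 hy)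
    simp only [norm_mul, Real.norm_eq_abs, abs_exp, one_mul]
    nlinarith [mul_le_mul_of_nonneg_left (hb y) (exp_pos (y - x)).le,
      mul_le_mul_of_nonneg_right h2 (hG0 y)]
  rw [integral_add h1 hG.integrableOn, integral_const_mul, integral_exp_sub_Iic one_pos] at h3
  linarith [setIntegral_le_integral (s := Iic x) hG (ae_of_all _ hG0)]

theorem abs_expRight_le (hb : ∀ y, |g y| ≤ C + G y)
    (hG0 : ∀ y, 0 ≤ G y) (hG : Integrable G) (x : ℝ) : |expRight g x| ≤ C + ∫ y, G y := by
  have h1 := (integrableOn_exp_sub_Ioi one_pos x).const_mul C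
  have h3 : |expRight g x| ≤ ∫ y in Ioi x, (C * exp (1 * (x - y)) + G y) := by
    rw [← Real.norm_eq_abs, expRight]
    refine norm_integral_le_of_norm_le (h1.add hG.integrableOn) ?_
    refine (ae_restrict_iff' measurableSet_Ioi).2 (ae_of_all _ fun y hy => ?_)
    have h2 : exp (x - y) ≤ 1 := exp_le_one_iff.2 (sub_nonpos.2 (mem_Ioi.1 hy).le)
    simp only [norm_mul, Real.norm_eq_abs, abs_exp, one_mul]
    nlinarith [mul_le_mul_of_nonneg_left (hb y) (exp_pos (x - y)).le,
      mul_le_mul_of_nonneg_right h2 (hG0 y)]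
  rw [integral_add h1 hG.integrableOn, integral_const_mul, integral_exp_sub_Ioi one_pos] at h3
  linarith [setIntegral_le_integral (s := Ioi x) hG (ae_of_all _ hG0)]

theorem hasDerivAt_expLeft (hg : Continuous g) (hb : ∀ y, |g y| ≤ C + G y)
    (hG0 : ∀ y, 0 ≤ G y) (hG : Integrable G) (x : ℝ) :
    HasDerivAt (expLeft g) (g x - expLeft g x) x := by
  have hi : ∀ x, IntegrableOn (fun y => exp y * g y) (Iic x) := fun x => by
    refine ((integrableOn_expLeft hg hb hG0 hG x).const_mul (exp x)).congr
      (ae_of_all _ fun y => ?_)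
    simp only [← mul_assoc, ← exp_add]
    congr 2; ring
  have he : ∀ x, expLeft g x = exp (-x) * ∫ y in Iic x, exp y * g y := fun x => by
    rw [← integral_const_mul]
    refine integral_congr_ae (ae_of_all _ fun y => ?_)
    simp only [← mul_assoc, ← exp_add]
    congr 2; ring
  have hc : Continuous fun y => exp y * g y := by fun_prop
  have hd : HasDerivAt (fun x => ∫ y in Iic x, exp y * g y) (exp x * g x) x := by
    have h1 := (hc.integral_hasStrictDerivAt 0 x).hasDerivAt.add_const
      (∫ y in Iic 0, exp y * g y)
    refine h1.congr_of_eventuallyEq (Eventually.of_forall fun z => ?_)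
    simp only
    rw [← intervalIntegral.integral_Iic_sub_Iic (hi 0) (hi z)]; ring
  have h2 := (hasDerivAt_neg x).exp.mul hd
  refine (h2.congr_of_eventuallyEq (Eventually.of_forall he)).congr_deriv ?_
  rw [he x, ← mul_assoc, ← exp_add]
  simp; ring

theorem hasDerivAt_expRight (hg : Continuous g) (hb : ∀ y, |g y| ≤ C + G y)
    (hG0 : ∀ y, 0 ≤ G y) (hG : Integrable G) (x : ℝ) :
    HasDerivAt (expRight g) (expRight g x - g x) x := by
  have hi : ∀ x, IntegrableOn (fun y => exp (-y) * g y) (Ioi x) := fun x => by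
    refine ((integrableOn_expRight hg hb hG0 hG x).const_mul (exp (-x))).congr
      (ae_of_all _ fun y => ?_)
    simp only [← mul_assoc, ← exp_add]
    congr 2; ring
  have he : ∀ x, expRight g x = exp x * ∫ y in Ioi x, exp (-y) * g y := fun x => by
    rw [← integral_const_mul]
    refine integral_congr_ae (ae_of_all _ fun y => ?_)
    simp only [← mul_assoc, ← exp_add]
    congr 2
  have hc : Continuous fun y => exp (-y) * g y := by fun_prop
  have hd : HasDerivAt (fun x => ∫ y in Ioi x, exp (-y) * g y) (-(exp (-x) * g x)) x := by
    have h1 := (hc.integral_hasStrictDerivAt 0 x).hasDerivAt.const_sub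
      (∫ y in Ioi 0, exp (-y) * g y)
    refine h1.congr_of_eventuallyEq (Eventually.of_forall fun z => ?_)
    simp only
    rw [← intervalIntegral.integral_Ioi_sub_Ioi' (hi 0) (hi z)]; ring
  have h2 := (hasDerivAt_exp x).mul hd
  refine (h2.congr_of_eventuallyEq (Eventually.of_forall he)).congr_deriv ?_
  rw [he x, mul_neg, ← mul_assoc (exp x) (exp (-x)), ← exp_add]
  simp; ring

end ExpAverage

/-- If functions tending uniformly to zero have derivatives tending uniformly to `α`, then
`α` vanishes. -/
theorem eq_zero_of_uniform_deriv_limit {α : ℝ → ℝ} {a b : ℝ} {F F' : ℕ → ℝ → ℝ} {ε : ℕ → ℝ}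
    (hε : Tendsto ε atTop (𝓝 0))
    (hF : ∀ n, ∀ t ∈ Ioo a b, HasDerivAt (F n) (F' n t) t)
    (h0 : ∀ n, ∀ t ∈ Ioo a b, |F n t| ≤ ε n)
    (h1 : ∀ n, ∀ t ∈ Ioo a b, |F' n t - α t| ≤ ε n) {t : ℝ} (ht : t ∈ Ioo a b) : α t = 0 := by
  have h := hasDerivAt_of_tendstoUniformlyOn (f := F) (f' := F') (g := fun _ => 0) (g' := α)
    (l := atTop) isOpen_Ioo ?_ (Eventually.of_forall hF) ?_ ht
  · exact h.unique (hasDerivAt_const t 0)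
  · rw [Metric.tendstoUniformlyOn_iff]
    intro δ hδ
    filter_upwards [hε.eventually_lt_const hδ] with n hn x hx
    rw [dist_comm, Real.dist_eq]
    exact (h1 n x hx).trans_lt hn
  · intro x hx
    exact squeeze_zero_norm (fun n => h0 n x hx) hε

/-- A lower semicontinuous function which is constant on every closed interval on which it is
bounded above is constant. -/
theorem eq_of_const_on_bounded_intervals {f : ℝ → ℝ} {c : ℝ} (hc : 0 ≤ c)
    (hlsc : ∀ K, IsClosed {s | s ∈ Icc 0 c ∧ f s ≤ K})
    (hconst : ∀ a b K, 0 ≤ a → a < b → b ≤ c → (∀ t ∈ Icc a b, f t ≤ K) → f a = f b) :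
    f 0 = f c := by
  set good : ℝ → Prop := fun x => ∃ K, ∀ᶠ s in 𝓝 x, s ∈ Icc 0 c → f s ≤ K with hgood
  have hbdd : ∀ a b, 0 ≤ a → b ≤ c → (∀ x ∈ Icc a b, good x) → ∃ K, ∀ x ∈ Icc a b, f x ≤ K := by
    intro a b ha hb hab
    refine isCompact_Icc.induction_on (p := fun s => ∃ K, ∀ x ∈ s, f x ≤ K) ⟨0, by simp⟩ ?_ ?_ ?_
    · rintro s t hst ⟨K, hK⟩
      exact ⟨K, fun x hx => hK x (hst hx)⟩
    · rintro s t ⟨K, hK⟩ ⟨K', hK'⟩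
      refine ⟨max K K', fun x hx => ?_⟩
      rcases hx with hx | hx
      · exact (hK x hx).trans (le_max_left _ _)
      · exact (hK' x hx).trans (le_max_right _ _)
    · intro x hx
      obtain ⟨K, hK⟩ := hab x hx
      refine ⟨{s | s ∈ Icc a b ∧ f s ≤ K}, ?_, K, fun y hy => hy.2⟩
      filter_upwards [self_mem_nhdsWithin, nhdsWithin_le_nhds hK] with s hs hs'
      exact ⟨hs, hs' ⟨ha.trans hs.1, hs.2.trans hb⟩⟩
  have hopen : IsOpen {x | good x} := by
    rw [isOpen_iff_mem_nhds]
    rintro x ⟨K, hK⟩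
    filter_upwards [eventually_eventually_nhds.2 hK] with y hy using ⟨K, hy⟩
  set B : Set ℝ := Icc 0 c ∩ {x | good x}ᶜ with hB
  have hBclosed : IsClosed B := isClosed_Icc.inter hopen.isClosed_compl
  rcases B.eq_empty_or_nonempty with hBe | hBne
  · rcases hc.eq_or_lt with rfl | hc'
    · rfl
    obtain ⟨K, hK⟩ := hbdd 0 c le_rfl le_rfl fun x hx => by
      by_contra hx'
      exact (hBe ▸ (⟨hx, hx'⟩ : x ∈ B) : x ∈ (∅ : Set ℝ))
    exact hconst 0 c K le_rfl hc' le_rfl hK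
  exfalso
  have : Nonempty B := hBne.to_subtype
  have : CompleteSpace B := hBclosed.completeSpace_coe
  obtain ⟨n, t₀, ht₀⟩ := nonempty_interior_of_iUnion_of_closed
    (f := fun n : ℕ => {t : B | f t ≤ n}) (fun n => by
      have h := (hlsc n).preimage (continuous_subtype_val (p := fun x => x ∈ B))
      convert h using 1
      ext t
      exact ⟨fun h => ⟨t.2.1, h⟩, fun h => h.2⟩) (by
      ext t
      simp only [mem_iUnion, Set.mem_ofPred_eq, mem_univ, iff_true]
      exact exists_nat_ge _)
  obtain ⟨ε, hε, hball⟩ := Metric.mem_nhds_iff.1 (mem_interior_iff_mem_nhds.1 ht₀)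
  have hBn : ∀ t ∈ B, |t - t₀| < ε → f t ≤ n := fun t ht h =>
    hball (a := ⟨t, ht⟩) (by rw [Metric.mem_ball, Subtype.dist_eq, Real.dist_eq]; exact h)
  refine t₀.2.2 ⟨n, ?_⟩
  filter_upwards [Metric.ball_mem_nhds (t₀ : ℝ) hε] with t ht htc
  rw [Metric.mem_ball, Real.dist_eq] at ht
  by_cases htB : t ∈ B
  · exact hBn t htB ht
  have hgoodt : ∀ s ∈ Icc 0 c, s ∉ B → good s := fun s hs h => by
    by_contra h'; exact h ⟨hs, h'⟩
  rcases lt_trichotomy t t₀ with hlt | heq | hgt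
  · obtain ⟨b, hb⟩ := ((isCompact_Icc (a := t) (b := t₀)).inter_left hBclosed).exists_isLeast
      ⟨t₀, t₀.2, hlt.le, le_rfl⟩
    have hbB : b ∈ B := hb.1.1
    have htb : t < b := lt_of_le_of_ne hb.1.2.1 fun h => htB (h ▸ hbB)
    have hnot : ∀ s ∈ Ico t b, s ∉ B := fun s hs h =>
      absurd (hb.2 ⟨h, hs.1, hs.2.le.trans hb.1.2.2⟩) (not_le.2 hs.2)
    have hconst' : ∀ s ∈ Ico t b, f s ≤ f t := by
      intro s hs
      rcases hs.1.eq_or_lt with rfl | hs1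
      · rfl
      obtain ⟨K, hK⟩ := hbdd t s htc.1 (hs.2.le.trans hbB.1.2) fun x hx =>
        hgoodt x ⟨htc.1.trans hx.1, hx.2.trans (hs.2.le.trans hbB.1.2)⟩
          (hnot x ⟨hx.1, hx.2.trans_lt hs.2⟩)
      exact (hconst t s K htc.1 hs1 (hs.2.le.trans hbB.1.2) hK).ge
    have heq := hconst t b (max (f t) (f b)) htc.1 htb hbB.1.2 fun s hs => by
      rcases hs.2.eq_or_lt with rfl | h
      · exact le_max_right _ _
      · exact (hconst' s ⟨hs.1, h⟩).trans (le_max_left _ _)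
    rw [heq]
    refine hBn b hbB ?_
    rw [abs_lt] at ht ⊢
    constructor <;> linarith [hb.1.2.2]
  · exact absurd t₀.2 (heq ▸ htB)
  · obtain ⟨b, hb⟩ := ((isCompact_Icc (a := (t₀ : ℝ)) (b := t)).inter_left
      hBclosed).exists_isGreatest ⟨t₀, t₀.2, le_rfl, hgt.le⟩
    have hbB : b ∈ B := hb.1.1
    have htb : b < t := lt_of_le_of_ne hb.1.2.2 fun h => htB (h ▸ hbB)
    have hnot : ∀ s ∈ Ioc b t, s ∉ B := fun s hs h =>
      absurd (hb.2 ⟨h, hb.1.2.1.trans hs.1.le, hs.2⟩) (not_le.2 hs.1)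
    have hconst' : ∀ s ∈ Ioc b t, f s ≤ f t := by
      intro s hs
      rcases hs.2.eq_or_lt with rfl | hs1
      · rfl
      have hs0 : 0 ≤ s := hbB.1.1.trans hs.1.le
      obtain ⟨K, hK⟩ := hbdd s t hs0 htc.2 fun x hx =>
        hgoodt x ⟨hs0.trans hx.1, hx.2.trans htc.2⟩ (hnot x ⟨hs.1.trans_le hx.1, hx.2⟩)
      exact (hconst s t K hs0 hs1 htc.2 hK).le
    have heq := hconst b t (max (f t) (f b)) hbB.1.1 htb htc.2 fun s hs => by
      rcases hs.1.eq_or_lt with rfl | h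
      · exact le_max_right _ _
      · exact (hconst' s ⟨h, hs.2⟩).trans (le_max_left _ _)
    rw [← heq]
    refine hBn b hbB ?_
    rw [abs_lt] at ht ⊢
    constructor <;> linarith [hb.1.2.1]

/-- Solutions of the Riccati inequality `y' ≤ -c₁ y² + c₂` starting below the negative
equilibrium have a bounded time of existence. -/
theorem riccati_lifespan_le {y y' : ℝ → ℝ} {T k a : ℝ} (hk : 0 < k) (ha : 0 < a)
    (hy : ContinuousOn y (Ico 0 T)) (hy' : ∀ t ∈ Ioo 0 T, HasDerivAt y (y' t) t)
    (hle : ∀ t ∈ Ioo 0 T, y' t ≤ -k * (y t ^ 2 - a ^ 2)) (h0 : y 0 < -a) :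
    T ≤ 1 / (2 * a * k) * log ((y 0 - a) / (y 0 + a)) := by
  have hinteg : ∀ s, interior (Icc (0 : ℝ) s) = Ioo 0 s := fun s => interior_Icc
  have hbelow : ∀ t ∈ Ico 0 T, y t < -a := by
    intro t ht
    by_contra! hge
    have hcont : ContinuousOn y (Icc 0 t) :=
      hy.mono fun s hs => ⟨hs.1, hs.2.trans_lt ht.2⟩
    obtain ⟨t₁, ht₁⟩ := (isCompact_Icc.of_isClosed_subset
      (hcont.preimage_isClosed_of_isClosed isClosed_Icc (isClosed_Ici (a := -a)))
      inter_subset_left).exists_isLeast ⟨t, ⟨ht.1, le_rfl⟩, hge⟩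
    have ht₁t : t₁ ≤ t := ht₁.1.1.2
    have hanti : AntitoneOn y (Icc 0 t₁) := by
      refine antitoneOn_of_deriv_nonpos (convex_Icc _ _)
        (hcont.mono (Icc_subset_Icc_right ht₁t)) ?_ ?_
      · rw [hinteg]
        exact fun s hs => (hy' s ⟨hs.1, (hs.2.le.trans ht₁t).trans_lt
          ht.2⟩).differentiableAt.differentiableWithinAt
      · rw [hinteg]
        intro s hs
        have hsT : s ∈ Ioo 0 T := ⟨hs.1, (hs.2.le.trans ht₁t).trans_lt ht.2⟩
        rw [(hy' s hsT).deriv]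
        refine (hle s hsT).trans ?_
        have hlt : y s < -a := by
          by_contra! h
          exact absurd (ht₁.2 ⟨⟨hs.1.le, hs.2.le.trans ht₁t⟩, h⟩) (not_le.2 hs.2)
        nlinarith [mul_pos hk (show 0 < y s ^ 2 - a ^ 2 by nlinarith)]
    have h1 := hanti ⟨le_rfl, ht₁.1.1.1⟩ ⟨ht₁.1.1.1, le_rfl⟩ ht₁.1.1.1
    have h2 : -a ≤ y t₁ := ht₁.1.2
    linarith
  refine le_of_forall_lt fun b hbT => ?_
  by_cases hb0 : b < 0
  · refine hb0.trans_le (mul_nonneg (by positivity) (log_nonneg ?_))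
    rw [le_div_iff_of_neg (by linarith)]
    linarith
  push Not at hb0
  obtain ⟨b', hbb', hb'T⟩ := exists_between hbT
  have hb'0 : 0 ≤ b' := hb0.trans hbb'.le
  set f : ℝ → ℝ := fun t => log (a - y t) - log (-a - y t) + 2 * a * k * t with hf
  have hneg : ∀ t ∈ Icc 0 b', 0 < -a - y t := fun t ht => by
    linarith [hbelow t ⟨ht.1, ht.2.trans_lt hb'T⟩]
  have hcont : ContinuousOn y (Icc 0 b') := hy.mono fun s hs => ⟨hs.1, hs.2.trans_lt hb'T⟩
  have hd : ∀ t ∈ Ioo 0 b', HasDerivAt f (-y' t / (a - y t) - -y' t / (-a - y t)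
      + 2 * a * k * 1) t := by
    intro t ht
    have hy1 := hy' t ⟨ht.1, ht.2.trans hb'T⟩
    have hn := hneg t ⟨ht.1.le, ht.2.le⟩
    exact (((hy1.const_sub a).log (by linarith)).sub ((hy1.const_sub (-a)).log hn.ne')).add
      ((hasDerivAt_id t).const_mul _)
  have hanti : AntitoneOn f (Icc 0 b') := by
    refine antitoneOn_of_deriv_nonpos (convex_Icc _ _) ?_ ?_ ?_
    · refine ContinuousOn.add (ContinuousOn.sub ?_ ?_) (by fun_prop)
      · exact (continuousOn_const.sub hcont).log fun t ht =>
          (by linarith [hneg t ht] : 0 < a - y t).ne'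
      · exact (continuousOn_const.sub hcont).log fun t ht => (hneg t ht).ne'
    · rw [hinteg]
      exact fun t ht => (hd t ht).differentiableAt.differentiableWithinAt
    · rw [hinteg]
      intro t ht
      rw [(hd t ht).deriv]
      have hn := hneg t ⟨ht.1.le, ht.2.le⟩
      have hp : 0 < a - y t := by linarith
      have hl := hle t ⟨ht.1, ht.2.trans hb'T⟩
      have key : -y' t / (a - y t) - -y' t / (-a - y t) + 2 * a * k * 1 =
          2 * a * (y' t + k * (y t ^ 2 - a ^ 2)) / ((a - y t) * (-a - y t)) := by
        field_simp; ring
      rw [key]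
      exact div_nonpos_of_nonpos_of_nonneg (by nlinarith) (by positivity)
  have h1 := hanti ⟨le_rfl, hb'0⟩ ⟨hb'0, le_rfl⟩ hb'0
  simp only [hf, mul_zero, add_zero] at h1
  have h2 : 0 < -a - y b' := hneg b' ⟨hb'0, le_rfl⟩
  have h3 : log (-a - y b') ≤ log (a - y b') := log_le_log h2 (by linarith)
  have h4 : log ((y 0 - a) / (y 0 + a)) = log (a - y 0) - log (-a - y 0) := by
    rw [← neg_div_neg_eq, log_div (by linarith) (by linarith)]
    congr 2 <;> ring
  rw [h4, one_div, lt_inv_mul_iff₀ (by positivity)]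
  have h5 : 2 * a * k * b < 2 * a * k * b' := by gcongr
  linarith

theorem sq_le_of_integrable_deriv {v v1 : ℝ → ℝ} (hv : ∀ x, HasDerivAt v (v1 x) x)
    (hc : Continuous v1) (i0 : Integrable fun x => v x ^ 2) (i1 : Integrable fun x => v1 x ^ 2)
    (hd : Tendsto v (cocompact ℝ) (𝓝 0)) (x : ℝ) :
    2 * v x ^ 2 ≤ ∫ y, (v y ^ 2 + v1 y ^ 2) := by
  have hcv : Continuous v := continuous_iff_continuousAt.2 fun y => (hv y).continuousAt
  have is : Integrable fun y => v y ^ 2 + v1 y ^ 2 := i0.add i1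
  have hinteg : Integrable fun y => 2 * v y * v1 y :=
    is.mono' (by fun_prop) (ae_of_all _ fun y => by
      rw [Real.norm_eq_abs, abs_le]
      constructor <;> nlinarith [sq_nonneg (v y + v1 y), sq_nonneg (v y - v1 y)])
  have hder : ∀ y, HasDerivAt (fun y => v y ^ 2) (2 * v y * v1 y) y := fun y =>
    ((hv y).fun_pow 2).congr_deriv (by ring)
  have h0 : Tendsto (fun y => v y ^ 2) (cocompact ℝ) (𝓝 0) := by
    simpa using hd.pow 2
  rw [cocompact_eq_atBot_atTop, tendsto_sup] at h0
  have hl := integral_Iic_of_hasDerivAt_of_tendsto' (a := x) (fun y _ => hder y)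
    hinteg.integrableOn h0.1
  have hr := integral_Ioi_of_hasDerivAt_of_tendsto' (a := x) (fun y _ => hder y)
    hinteg.integrableOn h0.2
  have hl' : ∫ y in Iic x, 2 * v y * v1 y ≤ ∫ y in Iic x, (v y ^ 2 + v1 y ^ 2) :=
    integral_mono hinteg.integrableOn is.integrableOn fun y => by
      simp only; nlinarith [sq_nonneg (v y - v1 y)]
  have hr' : ∫ y in Ioi x, -(2 * v y * v1 y) ≤ ∫ y in Ioi x, (v y ^ 2 + v1 y ^ 2) :=
    integral_mono hinteg.neg.integrableOn is.integrableOn fun y => by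
      simp only; nlinarith [sq_nonneg (v y + v1 y)]
  rw [integral_neg] at hr'
  rw [← intervalIntegral.integral_Iic_add_Ioi is.integrableOn is.integrableOn (b := x)]
  linarith

/-- A velocity `v` with derivative `v1` and a density `r` with the regularity, decay and bounds
that a classical solution has at each fixed time. -/
structure IsProfile (M : ℝ) (v v1 r : ℝ → ℝ) : Prop where
  hasDeriv : ∀ x, HasDerivAt v (v1 x) x
  cont1 : Continuous v1
  contr : Continuous r
  int0 : Integrable fun x => v x ^ 2
  int1 : Integrable fun x => v1 x ^ 2
  intr : Integrable fun x => (r x - 1) ^ 2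
  bound : ∀ x, |r x| ≤ M
  decay : Tendsto v (cocompact ℝ) (𝓝 0)

/-- The energy density. -/
def eDensity (κ : ℝ) (v v1 r : ℝ → ℝ) (x : ℝ) : ℝ := v x ^ 2 + v1 x ^ 2 + κ * (r x - 1) ^ 2

/-- The local part of the momentum flux. -/
noncomputable def flux (A κ Ω : ℝ) (v v1 r : ℝ → ℝ) (x : ℝ) : ℝ :=
  v x ^ 2 + v1 x ^ 2 / 2 - A * v x + κ / 2 * (r x ^ 2 - 1) - Ω * r x ^ 2 * v x

/-- `(1 - ∂²)⁻¹` applied to `flux + Ω ∂ (r² v1)`, written with exponential averages. -/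
noncomputable def nonlocalZ (A κ Ω : ℝ) (v v1 r : ℝ → ℝ) (x : ℝ) : ℝ :=
  (expLeft (fun y => flux A κ Ω v v1 r y + Ω * r y ^ 2 * v1 y) x
    + expRight (fun y => flux A κ Ω v v1 r y - Ω * r y ^ 2 * v1 y) x) / 2

/-- The companion of `nonlocalZ`, whose derivative is `nonlocalZ - flux`. -/
noncomputable def nonlocalD (A κ Ω : ℝ) (v v1 r : ℝ → ℝ) (x : ℝ) : ℝ :=
  (expRight (fun y => flux A κ Ω v v1 r y - Ω * r y ^ 2 * v1 y) x
    - expLeft (fun y => flux A κ Ω v v1 r y + Ω * r y ^ 2 * v1 y) x) / 2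

/-- The constant part of the bound for the integrands of the nonlocal terms. -/
noncomputable def fluxBound (A κ Ω M K : ℝ) : ℝ :=
  K + |A| * (1 + K) + κ / 2 * (M ^ 2 + 1) + Ω * M ^ 2 * (1 + K) + Ω * M ^ 2

/-- A bound for the nonlocal terms of a profile with energy at most `K`. -/
noncomputable def nonlocalBound (A κ Ω M K : ℝ) : ℝ := fluxBound A κ Ω M K + (1 + Ω * M ^ 2) * K

section Profile

variable {A κ Ω M K : ℝ} {v v1 r : ℝ → ℝ}

theorem IsProfile.cont0 (h : IsProfile M v v1 r) : Continuous v :=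
  continuous_iff_continuousAt.2 fun y => (h.hasDeriv y).continuousAt

theorem IsProfile.continuous_flux (h : IsProfile M v v1 r) : Continuous (flux A κ Ω v v1 r) := by
  have := h.cont0; have := h.cont1; have := h.contr
  unfold flux; fun_prop

theorem IsProfile.continuous_eDensity (h : IsProfile M v v1 r) :
    Continuous (eDensity κ v v1 r) := by
  have := h.cont0; have := h.cont1; have := h.contr
  unfold eDensity; fun_prop

theorem eDensity_nonneg (hκ : 0 ≤ κ) (x : ℝ) : 0 ≤ eDensity κ v v1 r x := by
  unfold eDensity; positivity

theorem IsProfile.integrable_eDensity (h : IsProfile M v v1 r) :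
    Integrable (eDensity κ v v1 r) :=
  (h.int0.add h.int1).add (h.intr.const_mul κ)

theorem IsProfile.integral_eDensity_eq (h : IsProfile M v v1 r) :
    ∫ y, eDensity κ v v1 r y
      = (∫ y, (v y ^ 2 + v1 y ^ 2)) + κ * ∫ y, (r y - 1) ^ 2 := by
  rw [← integral_const_mul]
  exact integral_add (h.int0.add h.int1) (h.intr.const_mul κ)

theorem IsProfile.integral_sq_add_sq_le (hκ : 0 ≤ κ) (h : IsProfile M v v1 r)
    (hK : ∫ y, eDensity κ v v1 r y ≤ K) : ∫ y, (v y ^ 2 + v1 y ^ 2) ≤ K := by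
  rw [h.integral_eDensity_eq] at hK
  have := mul_nonneg hκ (integral_nonneg (μ := volume) fun y => sq_nonneg (r y - 1))
  linarith

theorem IsProfile.sq_le (hκ : 0 ≤ κ) (h : IsProfile M v v1 r)
    (hK : ∫ y, eDensity κ v v1 r y ≤ K) (x : ℝ) : 2 * v x ^ 2 ≤ K :=
  (sq_le_of_integrable_deriv h.hasDeriv h.cont1 h.int0 h.int1 h.decay x).trans
    (h.integral_sq_add_sq_le hκ hK)

theorem IsProfile.integral_deriv_sq_le (hκ : 0 ≤ κ) (h : IsProfile M v v1 r)
    (hK : ∫ y, eDensity κ v v1 r y ≤ K) : ∫ y, v1 y ^ 2 ≤ K := by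
  refine le_trans ?_ (h.integral_sq_add_sq_le hκ hK)
  exact integral_mono h.int1 (h.int0.add h.int1) fun y => by
    simp only; nlinarith [sq_nonneg (v y)]

theorem abs_flux_add_le (hκ : 0 ≤ κ) (hΩ : 0 ≤ Ω) {a p s q : ℝ} (ha : 2 * a ^ 2 ≤ K)
    (hs : |s| ≤ M) (hq : |q| = |p|) :
    |a ^ 2 + p ^ 2 / 2 - A * a + κ / 2 * (s ^ 2 - 1) - Ω * s ^ 2 * a + Ω * s ^ 2 * q|
      ≤ fluxBound A κ Ω M K + (1 + Ω * M ^ 2) * p ^ 2 := by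
  have hs2 : s ^ 2 ≤ M ^ 2 := sq_le_sq' (abs_le.1 hs).1 (abs_le.1 hs).2
  have ha1 : |a| ≤ 1 + K := by nlinarith [sq_abs a, sq_nonneg (|a| - 1)]
  have hq1 : |q| ≤ 1 + p ^ 2 := by rw [hq]; nlinarith [sq_abs p, sq_nonneg (|p| - 1)]
  have h1 : |A * a| ≤ |A| * (1 + K) := by rw [abs_mul]; gcongr
  have h2 : |Ω * s ^ 2 * a| ≤ Ω * M ^ 2 * (1 + K) := by
    rw [abs_mul, abs_of_nonneg (by positivity : 0 ≤ Ω * s ^ 2)]; gcongr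
  have h3 : |Ω * s ^ 2 * q| ≤ Ω * M ^ 2 * (1 + p ^ 2) := by
    rw [abs_mul, abs_of_nonneg (by positivity : 0 ≤ Ω * s ^ 2)]; gcongr
  have h4 : κ / 2 * s ^ 2 ≤ κ / 2 * M ^ 2 := by gcongr
  unfold fluxBound
  rw [abs_le] at h1 h2 h3 ⊢
  constructor <;> nlinarith [sq_nonneg a, sq_nonneg p, mul_nonneg hκ (sq_nonneg s),
    mul_nonneg hκ (sq_nonneg M), mul_nonneg hΩ (sq_nonneg M)]

variable (hκ : 0 ≤ κ) (hΩ : 0 ≤ Ω) (h : IsProfile M v v1 r)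
  (hK : ∫ y, eDensity κ v v1 r y ≤ K)

include hκ hΩ h hK

theorem IsProfile.abs_left_integrand_le (y : ℝ) :
    |flux A κ Ω v v1 r y + Ω * r y ^ 2 * v1 y|
      ≤ fluxBound A κ Ω M K + (1 + Ω * M ^ 2) * v1 y ^ 2 :=
  abs_flux_add_le hκ hΩ (h.sq_le hκ hK y) (h.bound y) rfl

theorem IsProfile.abs_right_integrand_le (y : ℝ) :
    |flux A κ Ω v v1 r y - Ω * r y ^ 2 * v1 y|
      ≤ fluxBound A κ Ω M K + (1 + Ω * M ^ 2) * v1 y ^ 2 := by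
  have := abs_flux_add_le (A := A) hκ hΩ (h.sq_le hκ hK y) (h.bound y) (abs_neg (v1 y))
  rwa [mul_neg, ← sub_eq_add_neg] at this

theorem IsProfile.abs_expLeft_le : ∀ x,
    |expLeft (fun y => flux A κ Ω v v1 r y + Ω * r y ^ 2 * v1 y) x|
      ≤ nonlocalBound A κ Ω M K := fun x => by
  refine (_root_.abs_expLeft_le (h.abs_left_integrand_le hκ hΩ hK)
    (fun y => by positivity) (h.int1.const_mul _) x).trans ?_
  rw [integral_const_mul, nonlocalBound]
  gcongr
  exact h.integral_deriv_sq_le hκ hK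

theorem IsProfile.abs_expRight_le : ∀ x,
    |expRight (fun y => flux A κ Ω v v1 r y - Ω * r y ^ 2 * v1 y) x|
      ≤ nonlocalBound A κ Ω M K := fun x => by
  refine (_root_.abs_expRight_le (h.abs_right_integrand_le hκ hΩ hK)
    (fun y => by positivity) (h.int1.const_mul _) x).trans ?_
  rw [integral_const_mul, nonlocalBound]
  gcongr
  exact h.integral_deriv_sq_le hκ hK

theorem IsProfile.abs_nonlocalZ_le (x : ℝ) :
    |nonlocalZ A κ Ω v v1 r x| ≤ nonlocalBound A κ Ω M K := by
  have h1 := abs_le.1 (h.abs_expLeft_le (A := A) hκ hΩ hK x)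
  have h2 := abs_le.1 (h.abs_expRight_le (A := A) hκ hΩ hK x)
  rw [nonlocalZ, abs_le]
  constructor <;> linarith

theorem IsProfile.abs_nonlocalD_le (x : ℝ) :
    |nonlocalD A κ Ω v v1 r x| ≤ nonlocalBound A κ Ω M K := by
  have h1 := abs_le.1 (h.abs_expLeft_le (A := A) hκ hΩ hK x)
  have h2 := abs_le.1 (h.abs_expRight_le (A := A) hκ hΩ hK x)
  rw [nonlocalD, abs_le]
  constructor <;> linarith

omit hK

theorem IsProfile.hasDerivAt_expLeft (x : ℝ) :
    HasDerivAt (expLeft fun y => flux A κ Ω v v1 r y + Ω * r y ^ 2 * v1 y)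
      (flux A κ Ω v v1 r x + Ω * r x ^ 2 * v1 x
        - expLeft (fun y => flux A κ Ω v v1 r y + Ω * r y ^ 2 * v1 y) x) x := by
  have := h.continuous_flux (A := A) (κ := κ) (Ω := Ω)
  have := h.cont1; have := h.contr
  exact _root_.hasDerivAt_expLeft (by fun_prop) (h.abs_left_integrand_le hκ hΩ le_rfl)
    (fun y => by positivity) (h.int1.const_mul _) x

theorem IsProfile.hasDerivAt_expRight (x : ℝ) :
    HasDerivAt (expRight fun y => flux A κ Ω v v1 r y - Ω * r y ^ 2 * v1 y)
      (expRight (fun y => flux A κ Ω v v1 r y - Ω * r y ^ 2 * v1 y) x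
        - (flux A κ Ω v v1 r x - Ω * r x ^ 2 * v1 x)) x := by
  have := h.continuous_flux (A := A) (κ := κ) (Ω := Ω)
  have := h.cont1; have := h.contr
  exact _root_.hasDerivAt_expRight (by fun_prop) (h.abs_right_integrand_le hκ hΩ le_rfl)
    (fun y => by positivity) (h.int1.const_mul _) x

theorem IsProfile.hasDerivAt_nonlocalZ (x : ℝ) :
    HasDerivAt (nonlocalZ A κ Ω v v1 r)
      (Ω * r x ^ 2 * v1 x + nonlocalD A κ Ω v v1 r x) x :=
  (((h.hasDerivAt_expLeft hκ hΩ x).add (h.hasDerivAt_expRight hκ hΩ x)).div_const 2).congr_deriv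
    (by rw [nonlocalD]; ring)

theorem IsProfile.hasDerivAt_nonlocalD (x : ℝ) :
    HasDerivAt (nonlocalD A κ Ω v v1 r)
      (nonlocalZ A κ Ω v v1 r x - flux A κ Ω v v1 r x) x :=
  (((h.hasDerivAt_expRight hκ hΩ x).sub (h.hasDerivAt_expLeft hκ hΩ x)).div_const 2).congr_deriv
    (by rw [nonlocalZ]; ring)

end Profile

theorem tendsto_exp_sub_mul_atBot {g : ℝ → ℝ} (hg : Tendsto g atBot (𝓝 0)) (x : ℝ) :
    Tendsto (fun y => exp (y - x) * g y) atBot (𝓝 0) := by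
  simpa [← sub_eq_add_neg] using (tendsto_exp_atBot.comp
    (tendsto_atBot_add_const_right _ (-x) tendsto_id)).mul hg

theorem tendsto_exp_sub_mul_atTop {g : ℝ → ℝ} (hg : Tendsto g atTop (𝓝 0)) (x : ℝ) :
    Tendsto (fun y => exp (x - y) * g y) atTop (𝓝 0) := by
  simpa [← sub_eq_add_neg] using (tendsto_exp_atBot.comp
    (tendsto_atBot_add_const_left _ x tendsto_neg_atTop_atBot)).mul hg

theorem mul_abs_le_half_sq_add_sq (e c : ℝ) : e * |c| ≤ (e ^ 2 + c ^ 2) / 2 := by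
  nlinarith [sq_nonneg (e - |c|), sq_abs c]

section Profile

variable {A κ Ω M E : ℝ} {v v1 r : ℝ → ℝ}

theorem IsProfile.integrableOn_left (h : IsProfile M v v1 r) (hg : ∀ y, |v y| ≤ E) (x : ℝ) :
    IntegrableOn (fun y => exp (y - x) * (v y + v1 y)) (Iic x) := by
  have h0 := h.cont0; have h1 := h.cont1
  refine integrableOn_expLeft (C := E + 1) (G := fun y => v1 y ^ 2) (by fun_prop) (fun y => ?_)
    (fun y => sq_nonneg _) h.int1 x
  have h2 : |v1 y| ≤ 1 + v1 y ^ 2 := by nlinarith [sq_abs (v1 y), sq_nonneg (|v1 y| - 1)]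
  linarith [abs_add_le (v y) (v1 y), hg y]

theorem IsProfile.integrableOn_right (h : IsProfile M v v1 r) (hg : ∀ y, |v y| ≤ E) (x : ℝ) :
    IntegrableOn (fun y => exp (x - y) * (v y - v1 y)) (Ioi x) := by
  have h0 := h.cont0; have h1 := h.cont1
  refine integrableOn_expRight (C := E + 1) (G := fun y => v1 y ^ 2) (by fun_prop) (fun y => ?_)
    (fun y => sq_nonneg _) h.int1 x
  have h2 : |v1 y| ≤ 1 + v1 y ^ 2 := by nlinarith [sq_abs (v1 y), sq_nonneg (|v1 y| - 1)]
  linarith [abs_sub (v y) (v1 y), hg y]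

theorem IsProfile.integral_left (h : IsProfile M v v1 r) (hg : ∀ y, |v y| ≤ E) (x : ℝ) :
    ∫ y in Iic x, exp (y - x) * (v y + v1 y) = v x := by
  have hd := h.decay
  rw [cocompact_eq_atBot_atTop, tendsto_sup] at hd
  have := integral_Iic_of_hasDerivAt_of_tendsto' (a := x) (f := fun y => exp (y - x) * v y)
    (f' := fun y => exp (y - x) * (v y + v1 y))
    (fun y _ => ((((hasDerivAt_id y).sub_const x).exp).mul (h.hasDeriv y)).congr_deriv
      (by simp only [id]; ring))
    (h.integrableOn_left hg x) (tendsto_exp_sub_mul_atBot hd.1 x)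
  simpa using this

theorem IsProfile.integral_right (h : IsProfile M v v1 r) (hg : ∀ y, |v y| ≤ E) (x : ℝ) :
    ∫ y in Ioi x, exp (x - y) * (v y - v1 y) = v x := by
  have hd := h.decay
  rw [cocompact_eq_atBot_atTop, tendsto_sup] at hd
  have := integral_Ioi_of_hasDerivAt_of_tendsto' (a := x) (f := fun y => -(exp (x - y) * v y))
    (f' := fun y => exp (x - y) * (v y - v1 y))
    (fun y _ => ((((hasDerivAt_id y).const_sub x).exp).mul (h.hasDeriv y)).neg.congr_deriv
      (by simp only [id]; ring))
    (h.integrableOn_right hg x) (by simpa using (tendsto_exp_sub_mul_atTop hd.2 x).neg)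
  simpa using this

/-- The coefficient of the energy density in the bound for the exponential averages. -/
noncomputable def averageCoeff (A κ Ω M E : ℝ) : ℝ :=
  (A ^ 2 + Ω ^ 2) / 2 + Ω / √κ + Ω * √(E / 2) / κ + Ω * (M + 1) * (1 + κ) / (2 * κ)

theorem sq_mul_abs_add_abs_le (hκ : 0 < κ) {a p s : ℝ} (ha : |a| ≤ √(E / 2)) (hs : |s| ≤ M) :
    s ^ 2 * (|a| + |p|) ≤ |a| + |p| + (√(E / 2) / κ + 1 / √κ + (M + 1) * (1 + κ) / (2 * κ))
      * (a ^ 2 + p ^ 2 + κ * (s - 1) ^ 2) := by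
  set D := a ^ 2 + p ^ 2 + κ * (s - 1) ^ 2 with hD
  have hκ' : 0 < √κ := sqrt_pos.2 hκ
  have hM1 : 0 ≤ M + 1 := by linarith [abs_nonneg s]
  have t3 : |a| * (s - 1) ^ 2 ≤ √(E / 2) / κ * D := by
    have h1 : |a| * (s - 1) ^ 2 ≤ √(E / 2) * (s - 1) ^ 2 := by gcongr
    have h2 : (s - 1) ^ 2 ≤ D / κ := by
      rw [le_div_iff₀ hκ]; nlinarith [sq_nonneg a, sq_nonneg p]
    calc _ ≤ _ := h1
      _ ≤ √(E / 2) * (D / κ) := by gcongr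
      _ = _ := by ring
  have t4 : 2 * |a| * |s - 1| ≤ 1 / √κ * D := by
    rw [one_div, ← div_eq_inv_mul, le_div_iff₀ hκ']
    have h1 : (√κ * |s - 1|) ^ 2 = κ * (s - 1) ^ 2 := by rw [mul_pow, sq_abs, sq_sqrt hκ.le]
    nlinarith [sq_nonneg (|a| - √κ * |s - 1|), sq_abs a, sq_nonneg p]
  have t5 : |p| * |s - 1| ≤ (1 + κ) / (2 * κ) * D := by
    rw [div_mul_eq_mul_div, le_div_iff₀ (by positivity)]
    have h1 : 2 * (|p| * |s - 1|) ≤ p ^ 2 + (s - 1) ^ 2 := by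
      nlinarith [sq_nonneg (|p| - |s - 1|), sq_abs p, sq_abs (s - 1)]
    have h2 : κ * (p ^ 2 + (s - 1) ^ 2) ≤ (1 + κ) * D := by
      have : 0 ≤ a ^ 2 + p ^ 2 + κ * a ^ 2 + κ ^ 2 * (s - 1) ^ 2 := by positivity
      nlinarith
    nlinarith
  have hs1 : s ^ 2 ≤ (s - 1) ^ 2 + 2 * |s - 1| + 1 := by nlinarith [le_abs_self (s - 1)]
  have hs2 : s ^ 2 ≤ 1 + (M + 1) * |s - 1| := by
    have h1 : (s - 1) * (s + 1) ≤ |s - 1| * |s + 1| := by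
      rw [← abs_mul]; exact le_abs_self _
    have h2 : |s + 1| ≤ M + 1 := (abs_add_le _ _).trans (by simpa using hs)
    linarith [mul_le_mul_of_nonneg_left h2 (abs_nonneg (s - 1))]
  have u1 : s ^ 2 * |a| ≤ |a| + (√(E / 2) / κ * D + 1 / √κ * D) := by
    have := mul_le_mul_of_nonneg_right hs1 (abs_nonneg a)
    generalize √(E / 2) / κ * D = y1 at *
    generalize 1 / √κ * D = y2 at *
    linarith
  have u2 : s ^ 2 * |p| ≤ |p| + (M + 1) * ((1 + κ) / (2 * κ) * D) := by
    have := mul_le_mul_of_nonneg_right hs2 (abs_nonneg p)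
    have := mul_le_mul_of_nonneg_left t5 hM1
    generalize (1 + κ) / (2 * κ) * D = y1 at *
    linarith
  have hsplit : (√(E / 2) / κ + 1 / √κ + (M + 1) * (1 + κ) / (2 * κ)) * D
      = √(E / 2) / κ * D + 1 / √κ * D + (M + 1) * ((1 + κ) / (2 * κ) * D) := by ring
  rw [hsplit, mul_add]
  linarith

theorem exp_mul_le_average (hκ : 0 < κ) (hΩ : 0 ≤ Ω) {e a p s : ℝ} (he : 0 ≤ e) (he1 : e ≤ 1)
    (ha : |a| ≤ √(E / 2)) (hs : |s| ≤ M) :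
    e * (|A * p| + Ω * s ^ 2 * (|a| + |p|))
      ≤ 3 / 2 * e ^ 2 + averageCoeff A κ Ω M E * (a ^ 2 + p ^ 2 + κ * (s - 1) ^ 2) := by
  have hM1 : 0 ≤ M + 1 := by linarith [abs_nonneg s]
  have hu := sq_mul_abs_add_abs_le hκ (p := p) ha hs
  have hD1 : a ^ 2 + p ^ 2 ≤ a ^ 2 + p ^ 2 + κ * (s - 1) ^ 2 :=
    le_add_of_nonneg_right (by positivity)
  have hcoeff : averageCoeff A κ Ω M E = A ^ 2 / 2 + Ω ^ 2 / 2
      + Ω * (√(E / 2) / κ + 1 / √κ + (M + 1) * (1 + κ) / (2 * κ)) := by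
    rw [averageCoeff]; ring
  have hc : 0 ≤ √(E / 2) / κ + 1 / √κ + (M + 1) * (1 + κ) / (2 * κ) := by positivity
  have hD0 : 0 ≤ a ^ 2 + p ^ 2 + κ * (s - 1) ^ 2 := by positivity
  rw [hcoeff]
  generalize √(E / 2) / κ + 1 / √κ + (M + 1) * (1 + κ) / (2 * κ) = c at *
  generalize a ^ 2 + p ^ 2 + κ * (s - 1) ^ 2 = D at *
  have t1 : e * |A * p| ≤ e ^ 2 / 2 + A ^ 2 / 2 * D := by
    have := mul_abs_le_half_sq_add_sq e (A * p)
    nlinarith [mul_le_mul_of_nonneg_left hD1 (sq_nonneg A), mul_nonneg (sq_nonneg A) (sq_nonneg a)]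
  have t2 : e * (Ω * |a|) + e * (Ω * |p|) ≤ e ^ 2 + Ω ^ 2 / 2 * D := by
    have h1 := mul_abs_le_half_sq_add_sq e (Ω * a)
    have h2 := mul_abs_le_half_sq_add_sq e (Ω * p)
    rw [abs_mul, abs_of_nonneg hΩ] at h1 h2
    nlinarith [mul_le_mul_of_nonneg_left hD1 (sq_nonneg Ω)]
  have h3 := mul_le_mul_of_nonneg_left hu (mul_nonneg he hΩ)
  have h4 := mul_le_mul_of_nonneg_right he1 (mul_nonneg hΩ (mul_nonneg hc hD0))
  linarith

variable (hκ : 0 < κ) (h : IsProfile M v v1 r)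
  (hE : ∫ y, eDensity κ v v1 r y ≤ E)

include hκ h hE

theorem IsProfile.abs_le_sqrt (x : ℝ) : |v x| ≤ √(E / 2) :=
  Real.abs_le_sqrt (by linarith [h.sq_le hκ.le hE x])

theorem IsProfile.sub_nonlocalZ_le (hΩ : 0 ≤ Ω) (x : ℝ) :
    v x ^ 2 - A * v x + κ / 2 * (r x ^ 2 - 1) - Ω * r x ^ 2 * v x - nonlocalZ A κ Ω v v1 r x
      ≤ E / 2 + κ / 2 * M ^ 2 + Ω * M ^ 2 * √(E / 2) + 3 / 4 + averageCoeff A κ Ω M E / 2 * E := by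
  have hs := h.abs_le_sqrt hκ hE
  have hcf := h.continuous_flux (A := A) (κ := κ) (Ω := Ω)
  have h0 := h.cont0; have h1 := h.cont1; have hr := h.contr
  set P := averageCoeff A κ Ω M E with hP
  have hP0 : 0 ≤ P := by
    have : 0 ≤ M + 1 := by linarith [(abs_nonneg _).trans (h.bound 0)]
    rw [hP, averageCoeff]; positivity
  have ie := h.integrable_eDensity (κ := κ)
  have iL := integrableOn_expLeft (g := fun y => flux A κ Ω v v1 r y + Ω * r y ^ 2 * v1 y)
    (by fun_prop) (h.abs_left_integrand_le hκ.le hΩ le_rfl) (fun y => by positivity)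
    (h.int1.const_mul _) x
  have iR := integrableOn_expRight (g := fun y => flux A κ Ω v v1 r y - Ω * r y ^ 2 * v1 y)
    (by fun_prop) (h.abs_right_integrand_le hκ.le hΩ le_rfl) (fun y => by positivity)
    (h.int1.const_mul _) x
  have iL' := (h.integrableOn_left hs x).const_mul (-A)
  have iR' := (h.integrableOn_right hs x).const_mul (-A)
  have iL'' := (integrableOn_exp_sub_Iic one_pos x).const_mul (-(κ / 2))
  have iR'' := (integrableOn_exp_sub_Ioi one_pos x).const_mul (-(κ / 2))
  have jL := ((integrableOn_exp_sub_Iic two_pos x).const_mul (3 / 2)).add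
    (ie.const_mul P).integrableOn
  have jR := ((integrableOn_exp_sub_Ioi two_pos x).const_mul (3 / 2)).add
    (ie.const_mul P).integrableOn
  have kL : ∫ y in Iic x, (-A * (exp (y - x) * (v y + v1 y)) + -(κ / 2) * exp (1 * (y - x))
      - exp (y - x) * (flux A κ Ω v v1 r y + Ω * r y ^ 2 * v1 y))
      ≤ ∫ y in Iic x, (3 / 2 * exp (2 * (y - x)) + P * eDensity κ v v1 r y) := by
    refine setIntegral_mono_on ((iL'.add iL'').sub iL) jL measurableSet_Iic fun y hy => ?_
    have he1 : exp (y - x) ≤ 1 := exp_le_one_iff.2 (sub_nonpos.2 hy)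
    have hav := exp_mul_le_average (A := A) (p := v1 y) hκ hΩ (exp_pos _).le he1 (hs y) (h.bound y)
    have he2 : exp (2 * (y - x)) = exp (y - x) ^ 2 := by rw [← exp_nat_mul]; norm_num
    rw [he2, one_mul]
    refine le_trans ?_ hav
    have hle : -A * (v y + v1 y) - κ / 2 - (flux A κ Ω v v1 r y + Ω * r y ^ 2 * v1 y)
        ≤ |A * v1 y| + Ω * r y ^ 2 * (|v y| + |v1 y|) := by
      have c0 : 0 ≤ Ω * r y ^ 2 := by positivity
      rw [flux]
      nlinarith [neg_abs_le (A * v1 y), mul_le_mul_of_nonneg_left (le_abs_self (v y)) c0,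
        mul_le_mul_of_nonneg_left (neg_abs_le (v1 y)) c0, sq_nonneg (v y), sq_nonneg (v1 y),
        mul_nonneg hκ.le (sq_nonneg (r y))]
    nlinarith [mul_le_mul_of_nonneg_left hle (exp_pos (y - x)).le]
  have kR : ∫ y in Ioi x, (-A * (exp (x - y) * (v y - v1 y)) + -(κ / 2) * exp (1 * (x - y))
      - exp (x - y) * (flux A κ Ω v v1 r y - Ω * r y ^ 2 * v1 y))
      ≤ ∫ y in Ioi x, (3 / 2 * exp (2 * (x - y)) + P * eDensity κ v v1 r y) := by
    refine setIntegral_mono_on ((iR'.add iR'').sub iR) jR measurableSet_Ioi fun y hy => ?_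
    have he1 : exp (x - y) ≤ 1 := exp_le_one_iff.2 (sub_nonpos.2 (mem_Ioi.1 hy).le)
    have hav := exp_mul_le_average (A := A) (p := v1 y) hκ hΩ (exp_pos _).le he1 (hs y) (h.bound y)
    have he2 : exp (2 * (x - y)) = exp (x - y) ^ 2 := by rw [← exp_nat_mul]; norm_num
    rw [he2, one_mul]
    refine le_trans ?_ hav
    have hle : -A * (v y - v1 y) - κ / 2 - (flux A κ Ω v v1 r y - Ω * r y ^ 2 * v1 y)
        ≤ |A * v1 y| + Ω * r y ^ 2 * (|v y| + |v1 y|) := by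
      have c0 : 0 ≤ Ω * r y ^ 2 := by positivity
      rw [flux]
      nlinarith [le_abs_self (A * v1 y), mul_le_mul_of_nonneg_left (le_abs_self (v y)) c0,
        mul_le_mul_of_nonneg_left (le_abs_self (v1 y)) c0, sq_nonneg (v y), sq_nonneg (v1 y),
        mul_nonneg hκ.le (sq_nonneg (r y))]
    nlinarith [mul_le_mul_of_nonneg_left hle (exp_pos (x - y)).le]
  have iLs : IntegrableOn (fun y => -A * (exp (y - x) * (v y + v1 y))
      + -(κ / 2) * exp (1 * (y - x))) (Iic x) := iL'.add iL''
  rw [integral_sub iLs iL, integral_add iL' iL'',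
    integral_add ((integrableOn_exp_sub_Iic two_pos x).const_mul (3 / 2))
      (ie.const_mul P).integrableOn] at kL
  have iRs : IntegrableOn (fun y => -A * (exp (x - y) * (v y - v1 y))
      + -(κ / 2) * exp (1 * (x - y))) (Ioi x) := iR'.add iR''
  rw [integral_sub iRs iR, integral_add iR' iR'',
    integral_add ((integrableOn_exp_sub_Ioi two_pos x).const_mul (3 / 2))
      (ie.const_mul P).integrableOn] at kR
  simp only [integral_const_mul] at kL kR
  rw [h.integral_left hs, integral_exp_sub_Iic one_pos, integral_exp_sub_Iic two_pos] at kL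
  rw [h.integral_right hs, integral_exp_sub_Ioi one_pos, integral_exp_sub_Ioi two_pos] at kR
  have ksum := intervalIntegral.integral_Iic_add_Ioi (b := x) ie.integrableOn ie.integrableOn
  have kE : P * ((∫ y in Iic x, eDensity κ v v1 r y) + ∫ y in Ioi x, eDensity κ v v1 r y)
      ≤ P * E := by rw [ksum]; gcongr
  have hr2 : r x ^ 2 ≤ M ^ 2 := sq_le_sq' (abs_le.1 (h.bound x)).1 (abs_le.1 (h.bound x)).2
  have c1 : κ / 2 * r x ^ 2 ≤ κ / 2 * M ^ 2 := by
    exact mul_le_mul_of_nonneg_left hr2 (by positivity)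
  have c2 : -(Ω * r x ^ 2 * v x) ≤ Ω * M ^ 2 * √(E / 2) := by
    have h1 : Ω * r x ^ 2 * |v x| ≤ Ω * M ^ 2 * √(E / 2) := by
      exact mul_le_mul (mul_le_mul_of_nonneg_left hr2 hΩ) (hs x) (abs_nonneg _) (by positivity)
    nlinarith [mul_le_mul_of_nonneg_left (neg_abs_le (v x))
      (by positivity : 0 ≤ Ω * r x ^ 2)]
  have c3 := h.sq_le hκ.le hE x
  rw [nonlocalZ, expLeft, expRight]
  linarith

end Profile

theorem bound_le_Nconst {A Ω M E : ℝ} (hΩ : 0 ≤ Ω) (hκ : 0 < 1 - 2 * Ω * A) (hE : 0 < E) :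
    E / 2 + (1 - 2 * Ω * A) / 2 * M ^ 2 + Ω * M ^ 2 * √(E / 2) + 3 / 4
      + averageCoeff A (1 - 2 * Ω * A) Ω M E / 2 * E ≤ Nconst A Ω M E / (3 * E) := by
  rw [le_div_iff₀ (by positivity), Nconst, averageCoeff]
  have hs : √(E / 2) = √2 / 2 * √E := by
    rw [sqrt_div' _ zero_le_two, div_eq_iff (by positivity)]
    linear_combination -√E / 2 * mul_self_sqrt (zero_le_two (α := ℝ))
  have h2 : 1 ≤ √2 := Real.one_le_sqrt.2 one_le_two
  have h3 : 1 + (1 - 2 * Ω * A) = 2 * (1 - Ω * A) := by ring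
  rw [hs, h3]
  set κ := 1 - 2 * Ω * A with hκd
  have hκs := sqrt_pos.2 hκ
  have k1 : Ω / √κ * E ^ 2 ≤ √2 * (Ω / √κ * E ^ 2) := le_mul_of_one_le_left (by positivity) h2
  have k2 : 0 ≤ A ^ 2 * E ^ 2 := by positivity
  have k3 : 0 ≤ Ω ^ 2 * E ^ 2 := by positivity
  have e1 : 3 * √2 * Ω / (2 * √κ) = 3 / 2 * (√2 * (Ω / √κ)) := by field_simp
  have e2 : 3 * √2 * Ω / (4 * κ) = 3 / 4 * (√2 * Ω / κ) := by field_simp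
  have e3 : Ω * (√2 / 2 * √E) / κ = 1 / 2 * (√2 * Ω / κ) * √E := by field_simp
  have e4 : 3 * Ω * (1 - Ω * A) * (M + 1) / (2 * κ) = 3 / 2 * (Ω * (1 - Ω * A) * (M + 1) / κ) := by
    field_simp
  have e5 : Ω * (M + 1) * (2 * (1 - Ω * A)) / (2 * κ) = Ω * (1 - Ω * A) * (M + 1) / κ := by
    field_simp
  rw [e1, e2, e3, e4, e5]
  nlinarith

theorem Nconst_pos {A Ω M E : ℝ} (hΩ : 0 ≤ Ω) (hκ : 0 < 1 - 2 * Ω * A) (hM : 0 ≤ M) (hE : 0 < E) :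
    0 < Nconst A Ω M E := by
  have h1 : 0 < 1 - Ω * A := by linarith
  have hκs := sqrt_pos.2 hκ
  rw [Nconst]
  positivity

/-- The one-sided time derivative of `f` on `[0,T)`. -/
noncomputable def timeDeriv (T : ℝ) (f : ℝ → ℝ → ℝ) (t x : ℝ) : ℝ :=
  derivWithin (fun s => f s x) (Ico 0 T) t

/-- The mixed derivative `∂ₜ∂ₓ u`, recovered from `∂ₜ u` and `∂ₜ∂ₓ² u`. -/
noncomputable def mixedDeriv (T : ℝ) (u : ℝ → ℝ → ℝ) (t x : ℝ) : ℝ :=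
  timeDeriv T u t 1 - timeDeriv T u t 0
    - (∫ y in (0:ℝ)..1, (1 - y) * timeDeriv T (fun s => deriv (deriv (u s))) t y)
    + ∫ y in (0:ℝ)..x, timeDeriv T (fun s => deriv (deriv (u s))) t y

theorem eq_taylor_integral {v v1 v2 : ℝ → ℝ} (h0 : ∀ x, HasDerivAt v (v1 x) x)
    (h1 : ∀ x, HasDerivAt v1 (v2 x) x) (hc : Continuous v2) (x : ℝ) :
    v1 x = v 1 - v 0 - (∫ y in (0:ℝ)..1, (1 - y) * v2 y) + ∫ y in (0:ℝ)..x, v2 y := by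
  have e1 : ∫ y in (0:ℝ)..1, (1 - y) * v2 y = _ :=
    intervalIntegral.integral_eq_sub_of_hasDerivAt (f := fun y => (1 - y) * v1 y + v y)
      (fun y _ => ((((hasDerivAt_id y).const_sub 1).mul (h1 y)).add (h0 y)).congr_deriv
        (by simp only [id]; ring))
      (Continuous.intervalIntegrable (by fun_prop) _ _)
  have e2 : ∫ y in (0:ℝ)..x, v2 y = _ :=
    intervalIntegral.integral_eq_sub_of_hasDerivAt (fun y _ => h1 y)
      (hc.intervalIntegrable _ _)
  rw [e1, e2]
  ring

theorem continuousOn_primitive_param {F : ℝ → ℝ → ℝ} {s : Set ℝ}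
    (hF : ContinuousOn (fun p : ℝ × ℝ => F p.1 p.2) (s ×ˢ univ)) :
    ContinuousOn (fun p : ℝ × ℝ => ∫ y in (0:ℝ)..p.2, F p.1 y) (s ×ˢ univ) := by
  have h1 : ∀ p : ℝ × ℝ, ∫ y in (0:ℝ)..p.2, F p.1 y
      = p.2 * ∫ y in (0:ℝ)..1, F p.1 (p.2 * y) := fun p => by
    have := intervalIntegral.mul_integral_comp_mul_left (f := F p.1) (a := 0) (b := 1) p.2
    rw [this]; simp
  simp only [h1]
  refine continuousOn_snd.mul (continuousOn_intervalIntegral_param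
    (F := fun (p : ℝ × ℝ) y => F p.1 (p.2 * y)) ?_ 0 1)
  exact hF.comp (f := fun q : (ℝ × ℝ) × ℝ => (q.1.1, q.1.2 * q.2)) (by fun_prop)
    fun q hq => ⟨hq.1.1, mem_univ _⟩

theorem hasDerivAt_timeDeriv {T : ℝ} {f : ℝ → ℝ → ℝ} {x t : ℝ}
    (hf : ∀ x : ℝ, ∀ t ∈ Ico (0:ℝ) T, DifferentiableWithinAt ℝ (fun s => f s x) (Ico 0 T) t)
    (ht : t ∈ Ioo 0 T) : HasDerivAt (fun s => f s x) (timeDeriv T f t x) t :=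
  (hf x t ⟨ht.1.le, ht.2⟩).hasDerivWithinAt.hasDerivAt (Ico_mem_nhds ht.1 ht.2)

namespace R2CHSolution

variable {A μ σ Ω T : ℝ} {u ρ : ℝ → ℝ → ℝ} (hsol : R2CHSolution A μ σ Ω T u ρ)

include hsol

theorem hasDerivAt_u {t : ℝ} (ht : t ∈ Ico 0 T) (x : ℝ) :
    HasDerivAt (u t) (deriv (u t) x) x :=
  ((hsol.u_smooth t ht).differentiable (by norm_num) x).hasDerivAt

theorem contDiff_ux {t : ℝ} (ht : t ∈ Ico 0 T) : ContDiff ℝ 2 (deriv (u t)) :=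
  (contDiff_succ_iff_deriv.1 (show ContDiff ℝ (2 + 1) (u t) by
    simpa [show (2 : WithTop ℕ∞) + 1 = 3 by norm_num] using hsol.u_smooth t ht)).2.2

theorem contDiff_uxx {t : ℝ} (ht : t ∈ Ico 0 T) : ContDiff ℝ 1 (deriv (deriv (u t))) :=
  (contDiff_succ_iff_deriv.1 (show ContDiff ℝ (1 + 1) (deriv (u t)) by
    simpa [show (1 : WithTop ℕ∞) + 1 = 2 by norm_num] using hsol.contDiff_ux ht)).2.2

theorem hasDerivAt_ux {t : ℝ} (ht : t ∈ Ico 0 T) (x : ℝ) :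
    HasDerivAt (deriv (u t)) (deriv (deriv (u t)) x) x :=
  ((hsol.contDiff_ux ht).differentiable (by norm_num) x).hasDerivAt

theorem hasDerivAt_uxx {t : ℝ} (ht : t ∈ Ico 0 T) (x : ℝ) :
    HasDerivAt (deriv (deriv (u t))) (deriv (deriv (deriv (u t))) x) x :=
  ((hsol.contDiff_uxx ht).differentiable (by norm_num) x).hasDerivAt

theorem hasDerivAt_ρ {t : ℝ} (ht : t ∈ Ico 0 T) (x : ℝ) :
    HasDerivAt (ρ t) (deriv (ρ t) x) x :=
  ((hsol.ρ_smooth t ht).differentiable (by norm_num) x).hasDerivAt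

theorem continuousOn_u : ContinuousOn (fun p : ℝ × ℝ => u p.1 p.2) (Ico 0 T ×ˢ univ) := by
  simpa using hsol.u_jcont 0 (by norm_num)

theorem continuousOn_ux :
    ContinuousOn (fun p : ℝ × ℝ => deriv (u p.1) p.2) (Ico 0 T ×ˢ univ) := by
  simpa using hsol.u_jcont 1 (by norm_num)

theorem continuousOn_ρ : ContinuousOn (fun p : ℝ × ℝ => ρ p.1 p.2) (Ico 0 T ×ˢ univ) := by
  simpa using hsol.ρ_jcont 0 (by norm_num)

theorem hasDerivAt_time_u {t : ℝ} (ht : t ∈ Ioo 0 T) (x : ℝ) :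
    HasDerivAt (fun s => u s x) (timeDeriv T u t x) t :=
  hasDerivAt_timeDeriv hsol.u_tdiff ht

theorem hasDerivAt_time_uxx {t : ℝ} (ht : t ∈ Ioo 0 T) (x : ℝ) :
    HasDerivAt (fun s => deriv (deriv (u s)) x)
      (timeDeriv T (fun s => deriv (deriv (u s))) t x) t :=
  hasDerivAt_timeDeriv (f := fun s => deriv (deriv (u s))) hsol.uxx_tdiff ht

theorem hasDerivAt_time_ρ {t : ℝ} (ht : t ∈ Ioo 0 T) (x : ℝ) :
    HasDerivAt (fun s => ρ s x) (timeDeriv T ρ t x) t :=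
  hasDerivAt_timeDeriv hsol.ρ_tdiff ht

theorem continuousOn_time_u :
    ContinuousOn (fun p : ℝ × ℝ => timeDeriv T u p.1 p.2) (Ioo 0 T ×ˢ univ) :=
  hsol.ut_jcont.mono (prod_mono Ioo_subset_Ico_self subset_rfl)

theorem continuousOn_time_uxx : ContinuousOn
    (fun p : ℝ × ℝ => timeDeriv T (fun s => deriv (deriv (u s))) p.1 p.2) (Ioo 0 T ×ˢ univ) :=
  hsol.utxx_jcont.mono (prod_mono Ioo_subset_Ico_self subset_rfl)

theorem continuousOn_time_ρ :
    ContinuousOn (fun p : ℝ × ℝ => timeDeriv T ρ p.1 p.2) (Ioo 0 T ×ˢ univ) :=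
  hsol.ρt_jcont.mono (prod_mono Ioo_subset_Ico_self subset_rfl)

theorem hasDerivAt_time_ux {t : ℝ} (ht : t ∈ Ioo 0 T) (x : ℝ) :
    HasDerivAt (fun s => deriv (u s) x) (mixedDeriv T u t x) t := by
  have hz := hsol.continuousOn_time_uxx
  have hc : ∀ s ∈ Ioo 0 T, Continuous (deriv (deriv (u s))) := fun s hs =>
    (hsol.contDiff_uxx ⟨hs.1.le, hs.2⟩).continuous
  have h1 := hasDerivAt_intervalIntegral_param isOpen_Ioo
    (F := fun s y => (1 - y) * deriv (deriv (u s)) y)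
    (F' := fun s y => (1 - y) * timeDeriv T (fun s => deriv (deriv (u s))) s y)
    (fun s hs => by have := hc s hs; fun_prop) (by fun_prop)
    (fun s hs y => (hsol.hasDerivAt_time_uxx hs y).const_mul _) ht 0 1
  have h2 := hasDerivAt_intervalIntegral_param isOpen_Ioo hc hz
    (fun s hs y => hsol.hasDerivAt_time_uxx hs y) ht 0 x
  refine ((((hsol.hasDerivAt_time_u ht 1).sub (hsol.hasDerivAt_time_u ht 0)).sub h1).add
    h2).congr_of_eventuallyEq ?_
  filter_upwards [Ioo_mem_nhds ht.1 ht.2] with s hs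
  have hs' : s ∈ Ico 0 T := ⟨hs.1.le, hs.2⟩
  exact eq_taylor_integral (hsol.hasDerivAt_u hs') (hsol.hasDerivAt_ux hs') (hc s hs) x

theorem continuousOn_mixedDeriv :
    ContinuousOn (fun p : ℝ × ℝ => mixedDeriv T u p.1 p.2) (Ioo 0 T ×ˢ univ) := by
  have hz := hsol.continuousOn_time_uxx
  have hfst : MapsTo Prod.fst (Ioo (0 : ℝ) T ×ˢ (univ : Set ℝ)) (Ioo 0 T) := fun p hp => hp.1
  have hw : ∀ c : ℝ, ContinuousOn (fun p : ℝ × ℝ => timeDeriv T u p.1 c) (Ioo 0 T ×ˢ univ) :=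
    fun c => hsol.continuousOn_time_u.comp (f := fun p : ℝ × ℝ => (p.1, c)) (by fun_prop)
      fun p hp => ⟨hp.1, mem_univ _⟩
  have h1 : ContinuousOn (fun t => ∫ y in (0:ℝ)..1,
      (1 - y) * timeDeriv T (fun s => deriv (deriv (u s))) t y) (Ioo 0 T) :=
    continuousOn_intervalIntegral_param (by fun_prop) 0 1
  exact (((hw 1).sub (hw 0)).sub (h1.comp continuousOn_fst hfst)).add
    (continuousOn_primitive_param hz)

theorem hasDerivAt_mixedDeriv {t : ℝ} (ht : t ∈ Ioo 0 T) (x : ℝ) :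
    HasDerivAt (mixedDeriv T u t) (timeDeriv T (fun s => deriv (deriv (u s))) t x) x :=
  ((continuous_slice hsol.continuousOn_time_uxx ht).integral_hasStrictDerivAt 0
    x).hasDerivAt.const_add _

theorem hasDerivAt_timeDeriv_u {t : ℝ} (ht : t ∈ Ioo 0 T) (x : ℝ) :
    HasDerivAt (timeDeriv T u t) (mixedDeriv T u t x) x := by
  have hm := hsol.continuousOn_mixedDeriv
  have hc : ∀ s ∈ Ioo 0 T, Continuous (deriv (u s)) := fun s hs =>
    (hsol.contDiff_ux ⟨hs.1.le, hs.2⟩).continuous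
  have heq : ∀ x, timeDeriv T u t x = timeDeriv T u t 0 + ∫ y in (0:ℝ)..x, mixedDeriv T u t y := by
    intro x
    have h1 := (hsol.hasDerivAt_time_u ht 0).add (hasDerivAt_intervalIntegral_param isOpen_Ioo hc
      hm (fun s hs y => hsol.hasDerivAt_time_ux hs y) ht 0 x)
    refine (hsol.hasDerivAt_time_u ht x).unique (h1.congr_of_eventuallyEq ?_)
    filter_upwards [Ioo_mem_nhds ht.1 ht.2] with s hs
    have := intervalIntegral.integral_eq_sub_of_hasDerivAt (a := 0) (b := x)
      (fun y _ => hsol.hasDerivAt_u ⟨hs.1.le, hs.2⟩ y) ((hc s hs).intervalIntegrable _ _)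
    simp [this]
  exact (((continuous_slice hm ht).integral_hasStrictDerivAt 0 x).hasDerivAt.const_add
    (timeDeriv T u t 0)).congr_of_eventuallyEq (Eventually.of_forall heq)

end R2CHSolution

/-- The defect in the nonlocal form `w = -u u_x - D` of the momentum equation. -/
noncomputable def defect (A κ Ω : ℝ) (v v1 r w : ℝ → ℝ) (x : ℝ) : ℝ :=
  w x + v x * v1 x + nonlocalD A κ Ω v v1 r x

/-- The spatial derivative of `defect`. -/
noncomputable def defectDeriv (A κ Ω : ℝ) (v v1 v2 r wx : ℝ → ℝ) (x : ℝ) : ℝ :=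
  wx x + v1 x ^ 2 + v x * v2 x + nonlocalZ A κ Ω v v1 r x - flux A κ Ω v v1 r x

theorem exp_solution_eq {q r : ℝ → ℝ} (hq : ∀ x, HasDerivAt q (r x) x)
    (hr : ∀ x, HasDerivAt r (q x) x) {s : ℝ} (hs : s * s = 1) (x : ℝ) :
    q x + s * r x = exp (s * x) * (q 0 + s * r 0) := by
  have h : ∀ x, HasDerivAt (fun x => exp (-(s * x)) * (q x + s * r x)) 0 x := fun x =>
    ((((hasDerivAt_id' x).const_mul s).fun_neg.exp).mul ((hq x).fun_add ((hr x).const_mul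
      s))).congr_deriv
      (by linear_combination (-exp (-(s * x)) * r x) * hs)
  have := is_const_of_deriv_eq_zero (fun x => (h x).differentiableAt) (fun x => (h x).deriv) x 0
  simp only [mul_zero, neg_zero, exp_zero, one_mul] at this
  rw [← this, ← mul_assoc, ← exp_add]; simp

theorem integral_testFunction_mul {q r : ℝ → ℝ} (hq : ∀ x, HasDerivAt q (r x) x)
    (hr : ∀ x, HasDerivAt r (q x) x) {s : ℝ} (hs : s * s = 1) (X : ℝ) :
    ∫ y in (-1 : ℝ)..1, (cutoff 1 y - s * cutoffDeriv 1 y) * q (X + y)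
      = exp (s * X) * ((q 0 + s * r 0) * ∫ y in (-1 : ℝ)..1, cutoff 1 y * exp (s * y)) := by
  have hqc : Continuous q := continuous_iff_continuousAt.2 fun y => (hq y).continuousAt
  have hrc : Continuous r := continuous_iff_continuousAt.2 fun y => (hr y).continuousAt
  have hc1 := continuous_cutoff 1
  have hc2 := continuous_cutoffDeriv 1
  have h1 := integral_cutoff_mul_deriv one_pos (g := fun y => q (X + y))
    (fun y => HasDerivAt.comp_const_add X y (hq _)) (by fun_prop)
  have h2 : ∫ y in (-1 : ℝ)..1, (cutoff 1 y - s * cutoffDeriv 1 y) * q (X + y)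
      = (∫ y in (-1 : ℝ)..1, cutoff 1 y * q (X + y))
        - s * ∫ y in (-1 : ℝ)..1, cutoffDeriv 1 y * q (X + y) := by
    rw [← intervalIntegral.integral_const_mul, ← intervalIntegral.integral_sub
      (Continuous.intervalIntegrable (by fun_prop) _ _)
      (Continuous.intervalIntegrable (by fun_prop) _ _)]
    congr 1; ext y; ring
  have h3 : (∫ y in (-1 : ℝ)..1, cutoff 1 y * q (X + y))
        + s * ∫ y in (-1 : ℝ)..1, cutoff 1 y * r (X + y)
      = exp (s * X) * ((q 0 + s * r 0) * ∫ y in (-1 : ℝ)..1, cutoff 1 y * exp (s * y)) := by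
    rw [← intervalIntegral.integral_const_mul, ← intervalIntegral.integral_const_mul,
      ← intervalIntegral.integral_const_mul, ← intervalIntegral.integral_add
      (Continuous.intervalIntegrable (by fun_prop) _ _)
      (Continuous.intervalIntegrable (by fun_prop) _ _)]
    congr 1; ext y
    have := exp_solution_eq hq hr hs (X + y)
    rw [mul_add s, exp_add] at this
    linear_combination cutoff 1 y * this
  rw [h2, ← h3, h1]; ring

theorem integral_cutoff_mul_exp_pos (s : ℝ) :
    0 < ∫ y in (-1 : ℝ)..1, cutoff 1 y * exp (s * y) := by
  have := continuous_cutoff 1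
  refine intervalIntegral.intervalIntegral_pos_of_pos_on
    (Continuous.intervalIntegrable (by fun_prop) _ _) (fun y hy => ?_) (by norm_num)
  exact mul_pos (cutoff_pos one_pos (abs_lt.2 hy)) (exp_pos _)

theorem abs_testFunction_le {s : ℝ} (hs : |s| = 1) (y : ℝ) :
    |cutoff 1 y - s * cutoffDeriv 1 y| ≤ 5 := by
  have h1 := abs_cutoffDeriv_le one_pos y
  have h2 := cutoff_le_one 1 y
  refine (abs_sub _ _).trans ?_
  rw [abs_mul, hs, abs_of_nonneg (cutoff_nonneg 1 y)]
  linarith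

namespace R2CHSolution

variable {A Ω T M K : ℝ} {u ρ : ℝ → ℝ → ℝ} (hsol : R2CHSolution A 0 1 Ω T u ρ)

include hsol

theorem hasDerivAt_flux {t : ℝ} (ht : t ∈ Ico 0 T) (κ x : ℝ) :
    HasDerivAt (flux A κ Ω (u t) (deriv (u t)) (ρ t))
      (2 * u t x * deriv (u t) x + deriv (u t) x * deriv (deriv (u t)) x - A * deriv (u t) x
        + κ * ρ t x * deriv (ρ t) x
        - (2 * Ω * ρ t x * deriv (ρ t) x * u t x + Ω * ρ t x ^ 2 * deriv (u t) x)) x := by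
  have h0 := hsol.hasDerivAt_u ht x
  have h1 := hsol.hasDerivAt_ux ht x
  have h2 := hsol.hasDerivAt_ρ ht x
  refine (((((h0.fun_pow 2).add ((h1.fun_pow 2).div_const 2)).sub (h0.const_mul A)).add
    (((h2.fun_pow 2).sub_const 1).const_mul (κ / 2))).sub
    (((h2.fun_pow 2).const_mul Ω).mul h0)).congr_deriv ?_
  norm_num; ring

variable (hρM : ∀ t ∈ Ico (0:ℝ) T, ∀ x : ℝ, |ρ t x| ≤ M)

include hρM

theorem isProfile {t : ℝ} (ht : t ∈ Ico 0 T) : IsProfile M (u t) (deriv (u t)) (ρ t) where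
  hasDeriv := hsol.hasDerivAt_u ht
  cont1 := (hsol.contDiff_ux ht).continuous
  contr := (hsol.ρ_smooth t ht).continuous
  int0 := hsol.u_L2 t ht
  int1 := hsol.ux_L2 t ht
  intr := hsol.ρm1_L2 t ht
  bound := hρM t ht
  decay := hsol.u_decay t ht

theorem hasDerivAt_defect (hκ : 0 ≤ 1 - 2 * Ω * A) (hΩ : 0 ≤ Ω) {t : ℝ} (ht : t ∈ Ioo 0 T)
    (x : ℝ) :
    HasDerivAt (defect A (1 - 2 * Ω * A) Ω (u t) (deriv (u t)) (ρ t) (timeDeriv T u t))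
      (defectDeriv A (1 - 2 * Ω * A) Ω (u t) (deriv (u t)) (deriv (deriv (u t))) (ρ t)
        (mixedDeriv T u t) x) x := by
  have ht' := Ioo_subset_Ico_self ht
  refine (((hsol.hasDerivAt_timeDeriv_u ht x).add ((hsol.hasDerivAt_u ht' x).mul
    (hsol.hasDerivAt_ux ht' x))).add
    ((hsol.isProfile hρM ht').hasDerivAt_nonlocalD hκ hΩ x)).congr_deriv ?_
  rw [defectDeriv]; ring

theorem hasDerivAt_defectDeriv (hκ : 0 ≤ 1 - 2 * Ω * A) (hΩ : 0 ≤ Ω) {t : ℝ} (ht : t ∈ Ioo 0 T)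
    (x : ℝ) :
    HasDerivAt (defectDeriv A (1 - 2 * Ω * A) Ω (u t) (deriv (u t)) (deriv (deriv (u t))) (ρ t)
        (mixedDeriv T u t))
      (defect A (1 - 2 * Ω * A) Ω (u t) (deriv (u t)) (ρ t) (timeDeriv T u t) x) x := by
  have ht' := Ioo_subset_Ico_self ht
  have h0 := hsol.hasDerivAt_u ht' x
  have h1 := hsol.hasDerivAt_ux ht' x
  have hpr : deriv (fun y => ρ t y * u t y) x = _ := ((hsol.hasDerivAt_ρ ht' x).mul h0).deriv
  have he := hsol.eq_u t ht' x
  rw [hpr] at he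
  refine (((((hsol.hasDerivAt_mixedDeriv ht x).add (h1.fun_pow 2)).add
    (h0.mul (hsol.hasDerivAt_uxx ht' x))).add
    ((hsol.isProfile hρM ht').hasDerivAt_nonlocalZ hκ hΩ x)).sub
    (hsol.hasDerivAt_flux ht' _ x)).congr_deriv ?_
  rw [defect]
  simp only [timeDeriv] at he ⊢
  norm_num
  linear_combination -he

/-- The defect has no exponential component, because its averages are time derivatives of
bounded averages of `u` up to bounded terms. -/
theorem defect_component_eq_zero (hκ : 0 ≤ 1 - 2 * Ω * A) (hΩ : 0 ≤ Ω) {a b : ℝ} (ha : 0 ≤ a)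
    (hb : b ≤ T) (hK : ∀ t ∈ Ioo a b, energy Ω A u ρ t ≤ K) {t s : ℝ} (ht : t ∈ Ioo a b)
    (hs : |s| = 1) :
    defect A (1 - 2 * Ω * A) Ω (u t) (deriv (u t)) (ρ t) (timeDeriv T u t) 0
      + s * defectDeriv A (1 - 2 * Ω * A) Ω (u t) (deriv (u t)) (deriv (deriv (u t))) (ρ t)
        (mixedDeriv T u t) 0 = 0 := by
  have hss : s * s = 1 := by rw [← abs_mul_abs_self, hs, one_mul]
  have hsub : Ioo a b ⊆ Ioo 0 T := Ioo_subset_Ioo ha hb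
  have hsub' : Ioo a b ⊆ Ico 0 T := hsub.trans Ioo_subset_Ico_self
  set κ := 1 - 2 * Ω * A with hκd
  set χ : ℝ → ℝ := fun y => cutoff 1 y - s * cutoffDeriv 1 y with hχ
  have hχc : Continuous χ := by
    have := continuous_cutoff 1
    have := continuous_cutoffDeriv 1
    fun_prop
  have hχ5 : ∀ y, |χ y| ≤ 5 := abs_testFunction_le hs
  set I := ∫ y in (-1 : ℝ)..1, cutoff 1 y * exp (s * y) with hI
  have hIpos : 0 < I := integral_cutoff_mul_exp_pos s
  set c : ℝ → ℝ := fun t => defect A κ Ω (u t) (deriv (u t)) (ρ t) (timeDeriv T u t) 0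
      + s * defectDeriv A κ Ω (u t) (deriv (u t)) (deriv (deriv (u t))) (ρ t)
        (mixedDeriv T u t) 0 with hc
  set B := nonlocalBound A κ Ω M K with hB
  have hP : ∀ τ ∈ Ioo a b, IsProfile M (u τ) (deriv (u τ)) (ρ τ) := fun τ hτ =>
    hsol.isProfile hρM (hsub' hτ)
  suffices h : c t * I = 0 from (mul_eq_zero.1 h).resolve_right hIpos.ne'
  have hK0 : 0 ≤ K := (integral_nonneg fun x => eDensity_nonneg hκ x).trans (hK t ht)
  have hB0 : 0 ≤ B := (abs_nonneg _).trans ((hP t ht).abs_nonlocalD_le hκ hΩ (hK t ht) 0)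
  have hε : Tendsto (fun n : ℕ => exp (-(n : ℝ)) * (10 * (1 + K) + (5 * K + 10 * B))) atTop
      (𝓝 0) := by
    simpa using (tendsto_exp_neg_atTop_nhds_zero.comp tendsto_natCast_atTop_atTop).mul_const
      (10 * (1 + K) + (5 * K + 10 * B))
  refine eq_zero_of_uniform_deriv_limit (a := a) (b := b) (α := fun t => c t * I)
    (F := fun n τ => exp (-(n : ℝ)) * ∫ y in (-1 : ℝ)..1, χ y * u τ (s * n + y))
    (F' := fun n τ => exp (-(n : ℝ)) * ∫ y in (-1 : ℝ)..1, χ y * timeDeriv T u τ (s * n + y))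
    hε ?_ ?_ ?_ ht
  · intro n τ hτ
    refine (hasDerivAt_intervalIntegral_param (s := Ioo 0 T)
      (F := fun τ y => χ y * u τ (s * n + y)) (F' := fun τ y => χ y * timeDeriv T u τ (s * n + y))
      isOpen_Ioo ?_ ?_ ?_ (hsub hτ) (-1) 1).const_mul _
    · intro t' ht'
      have := (hsol.u_smooth t' (Ioo_subset_Ico_self ht')).continuous
      fun_prop
    · refine ContinuousOn.mul (by fun_prop) ?_
      exact hsol.continuousOn_time_u.comp (f := fun p : ℝ × ℝ => (p.1, s * n + p.2))
        (by fun_prop) fun p hp => ⟨hp.1, mem_univ _⟩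
    · exact fun t' ht' x => (hsol.hasDerivAt_time_u ht' _).const_mul _
  · intro n τ hτ
    rw [abs_mul, abs_of_pos (exp_pos _)]
    gcongr
    have : ‖∫ y in (-1 : ℝ)..1, χ y * u τ (s * n + y)‖ ≤ 5 * (1 + K) * |1 - (-1 : ℝ)| := by
      refine intervalIntegral.norm_integral_le_of_norm_le_const fun y _ => ?_
      have h1 := (hP τ hτ).sq_le hκ (hK τ hτ) (s * n + y)
      have h2 : |u τ (s * n + y)| ≤ 1 + K := by
        nlinarith [sq_abs (u τ (s * n + y)), sq_nonneg (|u τ (s * n + y)| - 1)]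
      rw [norm_mul]
      exact mul_le_mul (hχ5 y) h2 (norm_nonneg _) (by norm_num)
    rw [Real.norm_eq_abs] at this
    norm_num at this
    linarith
  · intro n τ hτ
    have hτ1 := hsub hτ
    have hτ2 := hsub' hτ
    have hp := hP τ hτ
    have c0 := hp.cont0
    have c1 := hp.cont1
    have cD : Continuous (nonlocalD A κ Ω (u τ) (deriv (u τ)) (ρ τ)) :=
      continuous_iff_continuousAt.2 fun y => (hp.hasDerivAt_nonlocalD hκ hΩ y).continuousAt
    have cw : Continuous (timeDeriv T u τ) :=
      continuous_iff_continuousAt.2 fun y => (hsol.hasDerivAt_timeDeriv_u hτ1 y).continuousAt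
    have hexp : exp (-(n : ℝ)) * exp (s * (s * n)) = 1 := by
      rw [← mul_assoc, hss, one_mul, ← exp_add]; simp
    have key := integral_testFunction_mul (hsol.hasDerivAt_defect hρM hκ hΩ hτ1)
      (hsol.hasDerivAt_defectDeriv hρM hκ hΩ hτ1) hss (s * n)
    have hsplit : ∫ y in (-1 : ℝ)..1, χ y * defect A κ Ω (u τ) (deriv (u τ)) (ρ τ)
          (timeDeriv T u τ) (s * n + y)
        = (∫ y in (-1 : ℝ)..1, χ y * timeDeriv T u τ (s * n + y))
          + ((∫ y in (-1 : ℝ)..1, χ y * (u τ (s * n + y) * deriv (u τ) (s * n + y)))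
          + ∫ y in (-1 : ℝ)..1, χ y * nonlocalD A κ Ω (u τ) (deriv (u τ)) (ρ τ) (s * n + y)) := by
      rw [← intervalIntegral.integral_add
        (Continuous.intervalIntegrable (by fun_prop) _ _)
        (Continuous.intervalIntegrable (by fun_prop) _ _), ← intervalIntegral.integral_add
        (Continuous.intervalIntegrable (by fun_prop) _ _)
        (Continuous.intervalIntegrable (by fun_prop) _ _)]
      congr 1; ext y; rw [defect]; ring
    have b1 : |∫ y in (-1 : ℝ)..1, χ y * (u τ (s * n + y) * deriv (u τ) (s * n + y))|
        ≤ 5 * K := by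
      have h1 : ‖∫ y in (-1 : ℝ)..1, χ y * (u τ (s * n + y) * deriv (u τ) (s * n + y))‖
          ≤ ∫ y in (-1 : ℝ)..1, 5 * (u τ (s * n + y) ^ 2 + deriv (u τ) (s * n + y) ^ 2) := by
        refine intervalIntegral.norm_integral_le_of_norm_le (by norm_num)
          (ae_of_all _ fun y _ => ?_) (Continuous.intervalIntegrable (by fun_prop) _ _)
        rw [norm_mul]
        refine mul_le_mul (hχ5 y) ?_ (norm_nonneg _) (by norm_num)
        rw [Real.norm_eq_abs, abs_le]
        constructor <;> nlinarith [sq_nonneg (u τ (s * n + y) + deriv (u τ) (s * n + y)),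
          sq_nonneg (u τ (s * n + y) - deriv (u τ) (s * n + y)), sq_nonneg (u τ (s * n + y)),
          sq_nonneg (deriv (u τ) (s * n + y))]
      rw [intervalIntegral.integral_const_mul, intervalIntegral.integral_comp_add_left
        (fun y => u τ y ^ 2 + deriv (u τ) y ^ 2)] at h1
      refine h1.trans ?_
      gcongr
      exact (intervalIntegral_le_integral (by linarith)
        (fun y => add_nonneg (sq_nonneg _) (sq_nonneg _))
        (hp.int0.add hp.int1)).trans (hp.integral_sq_add_sq_le hκ (hK τ hτ))
    have b2 : |∫ y in (-1 : ℝ)..1, χ y * nonlocalD A κ Ω (u τ) (deriv (u τ)) (ρ τ) (s * n + y)|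
        ≤ 10 * B := by
      have : ‖∫ y in (-1 : ℝ)..1, χ y * nonlocalD A κ Ω (u τ) (deriv (u τ)) (ρ τ) (s * n + y)‖
          ≤ 5 * B * |1 - (-1 : ℝ)| := by
        refine intervalIntegral.norm_integral_le_of_norm_le_const fun y _ => ?_
        rw [norm_mul]
        exact mul_le_mul (hχ5 y) (hp.abs_nonlocalD_le hκ hΩ (hK τ hτ) _) (norm_nonneg _)
          (by norm_num)
      rw [Real.norm_eq_abs] at this
      norm_num at this
      linarith
    have heq : exp (-(n : ℝ)) * (∫ y in (-1 : ℝ)..1, χ y * timeDeriv T u τ (s * n + y)) - c τ * I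
        = exp (-(n : ℝ)) *
          -((∫ y in (-1 : ℝ)..1, χ y * (u τ (s * n + y) * deriv (u τ) (s * n + y)))
          + ∫ y in (-1 : ℝ)..1, χ y * nonlocalD A κ Ω (u τ) (deriv (u τ)) (ρ τ) (s * n + y)) := by
      have key' := hsplit.symm.trans key
      linear_combination exp (-(n : ℝ)) * key' + c τ * I * hexp
    rw [heq, abs_mul, abs_of_pos (exp_pos _), abs_neg]
    gcongr
    linarith [abs_add_le
      (∫ y in (-1 : ℝ)..1, χ y * (u τ (s * n + y) * deriv (u τ) (s * n + y)))
      (∫ y in (-1 : ℝ)..1, χ y * nonlocalD A κ Ω (u τ) (deriv (u τ)) (ρ τ) (s * n + y))]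

theorem defect_eq_zero (hκ : 0 ≤ 1 - 2 * Ω * A) (hΩ : 0 ≤ Ω) {a b : ℝ} (ha : 0 ≤ a)
    (hb : b ≤ T) (hK : ∀ t ∈ Ioo a b, energy Ω A u ρ t ≤ K) {t : ℝ} (ht : t ∈ Ioo a b) (x : ℝ) :
    defect A (1 - 2 * Ω * A) Ω (u t) (deriv (u t)) (ρ t) (timeDeriv T u t) x = 0
      ∧ defectDeriv A (1 - 2 * Ω * A) Ω (u t) (deriv (u t)) (deriv (deriv (u t))) (ρ t)
        (mixedDeriv T u t) x = 0 := by
  have ht1 := Ioo_subset_Ioo ha hb ht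
  have h : ∀ s : ℝ, |s| = 1 → _ := fun s hs =>
    (exp_solution_eq (hsol.hasDerivAt_defect hρM hκ hΩ ht1)
      (hsol.hasDerivAt_defectDeriv hρM hκ hΩ ht1)
      (by rw [← abs_mul_abs_self, hs, one_mul]) x).trans
    (by rw [hsol.defect_component_eq_zero hρM hκ hΩ ha hb hK ht hs, mul_zero])
  have h1 := h 1 (by simp)
  have h2 := h (-1) (by simp)
  constructor <;> linarith

end R2CHSolution

/-- The energy flux. -/
noncomputable def energyFlux (A κ Ω : ℝ) (v v1 r : ℝ → ℝ) (x : ℝ) : ℝ :=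
  (A * v x ^ 2 + v x * v1 x ^ 2 + κ * (v x * (r x - 1) ^ 2)) / 2 + v x * nonlocalZ A κ Ω v v1 r x

theorem IsProfile.abs_le_one_add {M κ K : ℝ} {v v1 r : ℝ → ℝ} (hκ : 0 ≤ κ)
    (h : IsProfile M v v1 r) (hK : ∫ y, eDensity κ v v1 r y ≤ K) (x : ℝ) : |v x| ≤ 1 + K := by
  have h1 := h.sq_le hκ hK x
  nlinarith [sq_abs (v x), sq_nonneg (|v x| - 1)]

theorem IsProfile.abs_energyFlux_le {A κ Ω M K l : ℝ} {v v1 r : ℝ → ℝ} (hκ : 0 ≤ κ) (hΩ : 0 ≤ Ω)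
    (h : IsProfile M v v1 r) (hK : ∫ y, eDensity κ v v1 r y ≤ K) (hl : 0 < l) (x : ℝ) :
    |energyFlux A κ Ω v v1 r x| ≤ (|A| + (1 + K) + l) / 2 * eDensity κ v v1 r x
      + nonlocalBound A κ Ω M K ^ 2 / (2 * l) := by
  have h1 := h.abs_le_one_add hκ hK x
  have h2 := h.abs_nonlocalZ_le (A := A) hκ hΩ hK x
  have h3 := eDensity_nonneg (v := v) (v1 := v1) (r := r) hκ x
  have hD : eDensity κ v v1 r x = v x ^ 2 + v1 x ^ 2 + κ * (r x - 1) ^ 2 := rfl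
  have hs : 0 ≤ κ * (r x - 1) ^ 2 := by positivity
  set B := nonlocalBound A κ Ω M K
  have e1 : |A * v x ^ 2| ≤ |A| * eDensity κ v v1 r x := by
    rw [abs_mul, abs_of_nonneg (sq_nonneg (v x))]
    gcongr
    rw [hD]; nlinarith [sq_nonneg (v1 x)]
  have e2 : |v x * v1 x ^ 2 + κ * (v x * (r x - 1) ^ 2)| ≤ (1 + K) * eDensity κ v v1 r x := by
    rw [show v x * v1 x ^ 2 + κ * (v x * (r x - 1) ^ 2)
      = v x * (v1 x ^ 2 + κ * (r x - 1) ^ 2) by ring, abs_mul,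
      abs_of_nonneg (add_nonneg (sq_nonneg (v1 x)) hs)]
    refine mul_le_mul h1 ?_ (by positivity) ((abs_nonneg _).trans h1)
    rw [hD]; nlinarith [sq_nonneg (v x)]
  have e3 : |v x * nonlocalZ A κ Ω v v1 r x| ≤ l / 2 * eDensity κ v v1 r x + B ^ 2 / (2 * l) := by
    rw [abs_mul]
    have f1 : |v x| * |nonlocalZ A κ Ω v v1 r x| ≤ |v x| * B := by gcongr
    have f2 : |v x| * B ≤ l / 2 * v x ^ 2 + B ^ 2 / (2 * l) := by
      rw [← sq_abs (v x), show l / 2 * |v x| ^ 2 + B ^ 2 / (2 * l)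
        = ((l * |v x|) ^ 2 + B ^ 2) / (2 * l) by field_simp, le_div_iff₀ (by positivity)]
      nlinarith [sq_nonneg (l * |v x| - B)]
    have f3 : l / 2 * v x ^ 2 ≤ l / 2 * eDensity κ v v1 r x := by
      gcongr
      rw [hD]; nlinarith [sq_nonneg (v1 x)]
    linarith
  have t1 := abs_add_le (A * v x ^ 2) (v x * v1 x ^ 2 + κ * (v x * (r x - 1) ^ 2))
  have t2 := abs_add_le
    ((A * v x ^ 2 + (v x * v1 x ^ 2 + κ * (v x * (r x - 1) ^ 2))) / 2)
    (v x * nonlocalZ A κ Ω v v1 r x)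
  rw [abs_div, abs_two] at t2
  rw [energyFlux, show A * v x ^ 2 + v x * v1 x ^ 2 + κ * (v x * (r x - 1) ^ 2)
    = A * v x ^ 2 + (v x * v1 x ^ 2 + κ * (v x * (r x - 1) ^ 2)) by ring]
  linarith

namespace R2CHSolution

variable {A Ω T M K : ℝ} {u ρ : ℝ → ℝ → ℝ} (hsol : R2CHSolution A 0 1 Ω T u ρ)

include hsol

theorem continuousOn_localEnergy (R : ℝ) : ContinuousOn
    (fun t => ∫ x in (-R)..R, cutoff R x * eDensity (1 - 2 * Ω * A) (u t) (deriv (u t)) (ρ t) x)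
    (Ico 0 T) := by
  refine continuousOn_intervalIntegral_param
    (F := fun t x => cutoff R x * eDensity (1 - 2 * Ω * A) (u t) (deriv (u t)) (ρ t) x) ?_ _ _
  have h0 := hsol.continuousOn_u
  have h1 := hsol.continuousOn_ux
  have h2 := hsol.continuousOn_ρ
  have h3 := continuous_cutoff R
  unfold eDensity
  exact ContinuousOn.mul (by fun_prop)
    (((h0.pow 2).add (h1.pow 2)).add (((h2.sub continuousOn_const).pow 2).const_mul _))

variable (hρM : ∀ t ∈ Ico (0:ℝ) T, ∀ x : ℝ, |ρ t x| ≤ M)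

include hρM

theorem hasDerivAt_energyFlux (hκ : 0 ≤ 1 - 2 * Ω * A) (hΩ : 0 ≤ Ω) {a b : ℝ} (ha : 0 ≤ a)
    (hb : b ≤ T) (hK : ∀ t ∈ Ioo a b, energy Ω A u ρ t ≤ K) {t : ℝ} (ht : t ∈ Ioo a b) (x : ℝ) :
    HasDerivAt (energyFlux A (1 - 2 * Ω * A) Ω (u t) (deriv (u t)) (ρ t))
      (-(u t x * timeDeriv T u t x + deriv (u t) x * mixedDeriv T u t x
        + (1 - 2 * Ω * A) * ((ρ t x - 1) * timeDeriv T ρ t x))) x := by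
  have ht' : t ∈ Ico 0 T := Ioo_subset_Ico_self (Ioo_subset_Ioo ha hb ht)
  have h0 := hsol.hasDerivAt_u ht' x
  have h1 := hsol.hasDerivAt_ux ht' x
  have h2 := hsol.hasDerivAt_ρ ht' x
  have hpr : deriv (fun y => u t y * ρ t y) x = _ := (h0.mul h2).deriv
  have he := hsol.eq_ρ t ht' x
  rw [hpr] at he
  obtain ⟨d1, d2⟩ := hsol.defect_eq_zero hρM hκ hΩ ha hb hK ht x
  rw [defect] at d1
  rw [defectDeriv, flux] at d2
  refine ((((((h0.fun_pow 2).const_mul A).add (h0.mul (h1.fun_pow 2))).add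
    ((h0.mul ((h2.sub_const 1).fun_pow 2)).const_mul (1 - 2 * Ω * A))).div_const 2).add
    (h0.mul ((hsol.isProfile hρM ht').hasDerivAt_nonlocalZ hκ hΩ x))).congr_deriv ?_
  rw [show timeDeriv T ρ t x = -(deriv (u t) x * ρ t x + u t x * deriv (ρ t) x) by
    simp only [timeDeriv]; linarith]
  norm_num
  linear_combination u t x * d1 + deriv (u t) x * d2

theorem hasDerivAt_localEnergy (hκ : 0 ≤ 1 - 2 * Ω * A) (hΩ : 0 ≤ Ω) {a b : ℝ} (ha : 0 ≤ a)
    (hb : b ≤ T) (hK : ∀ t ∈ Ioo a b, energy Ω A u ρ t ≤ K) {t : ℝ} (ht : t ∈ Ioo a b)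
    {R : ℝ} (hR : 0 < R) :
    HasDerivAt (fun t => ∫ x in (-R)..R,
        cutoff R x * eDensity (1 - 2 * Ω * A) (u t) (deriv (u t)) (ρ t) x)
      (2 * ∫ x in (-R)..R,
        cutoffDeriv R x * energyFlux A (1 - 2 * Ω * A) Ω (u t) (deriv (u t)) (ρ t) x) t := by
  have hsub : Ioo a b ⊆ Ioo 0 T := Ioo_subset_Ioo ha hb
  have c3 := continuous_cutoff R
  have cw := hsol.continuousOn_time_u
  have cwx := hsol.continuousOn_mixedDeriv
  have cρ := hsol.continuousOn_time_ρ
  have hm : Ioo (0 : ℝ) T ×ˢ (univ : Set ℝ) ⊆ Ico 0 T ×ˢ univ :=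
    prod_mono Ioo_subset_Ico_self subset_rfl
  have c0 := hsol.continuousOn_u.mono hm
  have c1 := hsol.continuousOn_ux.mono hm
  have c2 := hsol.continuousOn_ρ.mono hm
  set g' : ℝ → ℝ → ℝ := fun t x => -(u t x * timeDeriv T u t x
    + deriv (u t) x * mixedDeriv T u t x + (1 - 2 * Ω * A) * ((ρ t x - 1) * timeDeriv T ρ t x))
    with hg'
  have cg' : ContinuousOn (fun p : ℝ × ℝ => g' p.1 p.2) (Ioo 0 T ×ˢ univ) :=
    (((c0.mul cw).add (c1.mul cwx)).add (((c2.sub continuousOn_const).mul cρ).const_mul _)).neg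
  refine (hasDerivAt_intervalIntegral_param (s := Ioo 0 T)
    (F := fun t x => cutoff R x * eDensity (1 - 2 * Ω * A) (u t) (deriv (u t)) (ρ t) x)
    (F' := fun t x => cutoff R x * (-2 * g' t x))
    isOpen_Ioo ?_ ?_ ?_ (hsub ht) (-R) R).congr_deriv ?_
  · intro s hs
    exact c3.mul (hsol.isProfile hρM (Ioo_subset_Ico_self hs)).continuous_eDensity
  · exact ContinuousOn.mul (by fun_prop) (cg'.const_mul _)
  · intro s hs x
    have d0 := hsol.hasDerivAt_time_u hs x
    have d1 := hsol.hasDerivAt_time_ux hs x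
    have d2 := hsol.hasDerivAt_time_ρ hs x
    refine ((((d0.fun_pow 2).add (d1.fun_pow 2)).add
      (((d2.sub_const 1).fun_pow 2).const_mul (1 - 2 * Ω * A))).const_mul
      (cutoff R x)).congr_deriv ?_
    simp only [hg']; norm_num; ring
  · have key := integral_cutoff_mul_deriv hR
      (hsol.hasDerivAt_energyFlux hρM hκ hΩ ha hb hK ht) (continuous_slice cg' (hsub ht))
    simp only [mul_left_comm (cutoff R _) (-2 : ℝ)]
    rw [intervalIntegral.integral_const_mul]
    change ∫ x in (-R)..R, cutoff R x * g' t x = _ at key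
    rw [key]; ring

theorem abs_integral_energyFlux_le (hκ : 0 ≤ 1 - 2 * Ω * A) (hΩ : 0 ≤ Ω) {t : ℝ}
    (ht : t ∈ Ico 0 T) (hK : energy Ω A u ρ t ≤ K) {l : ℝ} (hl : 1 ≤ l) :
    |2 * ∫ x in (-(l ^ 2))..(l ^ 2),
        cutoffDeriv (l ^ 2) x * energyFlux A (1 - 2 * Ω * A) Ω (u t) (deriv (u t)) (ρ t) x|
      ≤ (4 * (|A| + (1 + K)) * K + 4 * K + 8 * nonlocalBound A (1 - 2 * Ω * A) Ω M K ^ 2) / l := by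
  set κ := 1 - 2 * Ω * A
  set B := nonlocalBound A κ Ω M K
  have hp := hsol.isProfile hρM ht
  have hl0 : 0 < l := by linarith
  have hK0 : 0 ≤ K := (integral_nonneg fun x => eDensity_nonneg hκ x).trans hK
  have ce := hp.continuous_eDensity (κ := κ)
  have h1 : ‖∫ x in (-(l ^ 2))..(l ^ 2),
        cutoffDeriv (l ^ 2) x * energyFlux A κ Ω (u t) (deriv (u t)) (ρ t) x‖
      ≤ ∫ x in (-(l ^ 2))..(l ^ 2), 4 / l ^ 2 * ((|A| + (1 + K) + l) / 2
        * eDensity κ (u t) (deriv (u t)) (ρ t) x + B ^ 2 / (2 * l)) := by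
    refine intervalIntegral.norm_integral_le_of_norm_le (by nlinarith)
      (ae_of_all _ fun y _ => ?_) (Continuous.intervalIntegrable (by fun_prop) _ _)
    rw [norm_mul]
    exact mul_le_mul (abs_cutoffDeriv_le (by positivity) y)
      (hp.abs_energyFlux_le hκ hΩ hK hl0 y) (norm_nonneg _) (by positivity)
  rw [intervalIntegral.integral_const_mul, intervalIntegral.integral_add
    (Continuous.intervalIntegrable (by fun_prop) _ _)
    (Continuous.intervalIntegrable (by fun_prop) _ _), intervalIntegral.integral_const_mul,
    intervalIntegral.integral_const] at h1
  have h2 : ∫ x in (-(l ^ 2))..(l ^ 2), eDensity κ (u t) (deriv (u t)) (ρ t) x ≤ K :=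
    (intervalIntegral_le_integral (by nlinarith) (eDensity_nonneg hκ)
      hp.integrable_eDensity).trans hK
  have h3 : (|A| + (1 + K) + l) / 2
      * ∫ x in (-(l ^ 2))..(l ^ 2), eDensity κ (u t) (deriv (u t)) (ρ t) x
      ≤ (|A| + (1 + K) + l) / 2 * K := by gcongr
  rw [abs_mul, abs_two, ← Real.norm_eq_abs]
  calc _ ≤ 2 * (4 / l ^ 2 * ((|A| + (1 + K) + l) / 2 * K
        + (l ^ 2 - -(l ^ 2)) • (B ^ 2 / (2 * l)))) := by
        refine mul_le_mul_of_nonneg_left (h1.trans ?_) zero_le_two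
        gcongr
    _ = (4 * (|A| + (1 + K)) * K) / l ^ 2 + (4 * K + 8 * B ^ 2) / l := by
        rw [smul_eq_mul]; field_simp; ring
    _ ≤ (4 * (|A| + (1 + K)) * K) / l + (4 * K + 8 * B ^ 2) / l := by
        gcongr
        nlinarith
    _ = _ := by ring

theorem energy_eq_of_le (hκ : 0 ≤ 1 - 2 * Ω * A) (hΩ : 0 ≤ Ω) {a b : ℝ} (ha : 0 ≤ a)
    (hab : a < b) (hb : b < T) (hK : ∀ t ∈ Icc a b, energy Ω A u ρ t ≤ K) :
    energy Ω A u ρ a = energy Ω A u ρ b := by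
  have hK' : ∀ t ∈ Ioo a b, energy Ω A u ρ t ≤ K := fun t ht => hK t (Ioo_subset_Icc_self ht)
  have hsub : Icc a b ⊆ Ico 0 T := fun t ht => ⟨ha.trans ht.1, ht.2.trans_lt hb⟩
  set S : ℝ → ℝ → ℝ := fun R t => ∫ x in (-R)..R,
    cutoff R x * eDensity (1 - 2 * Ω * A) (u t) (deriv (u t)) (ρ t) x
  have hlim : ∀ t ∈ Icc a b, Tendsto (fun l : ℝ => S (l ^ 2) t) atTop (𝓝 (energy Ω A u ρ t)) :=
    fun t ht => (tendsto_integral_cutoff_mul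
      (hsol.isProfile hρM (hsub ht)).integrable_eDensity).comp (tendsto_pow_atTop two_ne_zero)
  set C := 4 * (|A| + (1 + K)) * K + 4 * K + 8 * nonlocalBound A (1 - 2 * Ω * A) Ω M K ^ 2
  have hbound : ∀ l : ℝ, 1 ≤ l → |S (l ^ 2) b - S (l ^ 2) a| ≤ C / l * (b - a) := by
    intro l hl
    obtain ⟨c, hc, hc'⟩ := exists_hasDerivAt_eq_slope (S (l ^ 2)) _ hab
      ((hsol.continuousOn_localEnergy (l ^ 2)).mono hsub)
      (fun t ht => hsol.hasDerivAt_localEnergy hρM hκ hΩ ha hb.le hK' ht (by positivity))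
    have := hsol.abs_integral_energyFlux_le hρM hκ hΩ (hsub (Ioo_subset_Icc_self hc))
      (hK' c hc) hl
    rw [hc', abs_div, abs_of_pos (sub_pos.2 hab), div_le_iff₀ (sub_pos.2 hab)] at this
    exact this
  have h1 : Tendsto (fun l : ℝ => |S (l ^ 2) b - S (l ^ 2) a|) atTop
      (𝓝 |energy Ω A u ρ b - energy Ω A u ρ a|) :=
    ((hlim b (right_mem_Icc.2 hab.le)).sub (hlim a (left_mem_Icc.2 hab.le))).abs
  have h2 : Tendsto (fun l : ℝ => C / l * (b - a)) atTop (𝓝 0) := by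
    simpa using (tendsto_id.const_div_atTop C).mul_const (b - a)
  have h3 := le_of_tendsto_of_tendsto h1 h2 ((eventually_ge_atTop 1).mono hbound)
  linarith [abs_nonpos_iff.1 h3]

theorem energy_eq (hκ : 0 ≤ 1 - 2 * Ω * A) (hΩ : 0 ≤ Ω) {t : ℝ} (ht : t ∈ Ico 0 T) :
    energy Ω A u ρ t = energy Ω A u ρ 0 := by
  refine (eq_of_const_on_bounded_intervals ht.1 (fun K => ?_)
    fun a b K ha hab hb hK => hsol.energy_eq_of_le hρM hκ hΩ ha hab (hb.trans_lt ht.2) hK).symm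
  have hsub : Icc 0 t ⊆ Ico 0 T := fun s hs => ⟨hs.1, hs.2.trans_lt ht.2⟩
  set S : ℝ → ℝ → ℝ := fun R t => ∫ x in (-R)..R,
    cutoff R x * eDensity (1 - 2 * Ω * A) (u t) (deriv (u t)) (ρ t) x
  have heq : {s | s ∈ Icc 0 t ∧ energy Ω A u ρ s ≤ K}
      = ⋂ R : Ioi (0 : ℝ), Icc 0 t ∩ S R ⁻¹' Iic K := by
    ext s
    simp only [mem_ofPred_eq, mem_iInter, mem_inter_iff, mem_preimage, mem_Iic]
    refine ⟨fun h R => ⟨h.1, ?_⟩, fun h => ⟨(h ⟨1, mem_Ioi.2 one_pos⟩).1, ?_⟩⟩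
    · have hp := hsol.isProfile hρM (hsub h.1)
      exact (integral_cutoff_mul_le (mem_Ioi.1 R.2) hp.continuous_eDensity (eDensity_nonneg hκ)
        hp.integrable_eDensity).trans h.2
    · have hp := hsol.isProfile hρM (hsub (h ⟨1, mem_Ioi.2 one_pos⟩).1)
      exact le_of_tendsto (tendsto_integral_cutoff_mul hp.integrable_eDensity)
        ((eventually_gt_atTop 0).mono fun R hR => (h ⟨R, hR⟩).2)
  rw [heq]
  exact isClosed_iInter fun R => ((hsol.continuousOn_localEnergy R).mono
    hsub).preimage_isClosed_of_isClosed isClosed_Icc isClosed_Iic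

end R2CHSolution

theorem sq_integral_cutoff_mul_cube_le {v : ℝ → ℝ} {E R : ℝ} (hv : Continuous v)
    (hi : Integrable fun x => v x ^ 2) (hE : ∫ x, v x ^ 2 ≤ E) (hE0 : 0 < E) (hR : 0 < R) :
    (∫ x in (-R)..R, cutoff R x * v x ^ 3) ^ 2 / E ≤ ∫ x in (-R)..R, cutoff R x * v x ^ 4 := by
  have hc := continuous_cutoff R
  set m := ∫ x in (-R)..R, cutoff R x * v x ^ 3
  have h1 : 0 ≤ ∫ x in (-R)..R, cutoff R x * (v x ^ 2 - m / E * v x) ^ 2 :=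
    intervalIntegral.integral_nonneg (by linarith) fun x _ =>
      mul_nonneg (cutoff_nonneg R x) (sq_nonneg _)
  have h2 : ∫ x in (-R)..R, cutoff R x * (v x ^ 2 - m / E * v x) ^ 2
      = (∫ x in (-R)..R, cutoff R x * v x ^ 4) - 2 * (m / E) * m
        + (m / E) ^ 2 * ∫ x in (-R)..R, cutoff R x * v x ^ 2 := by
    rw [← intervalIntegral.integral_const_mul, ← intervalIntegral.integral_const_mul,
      ← intervalIntegral.integral_sub (Continuous.intervalIntegrable (by fun_prop) _ _)
      (Continuous.intervalIntegrable (by fun_prop) _ _), ← intervalIntegral.integral_add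
      (Continuous.intervalIntegrable (by fun_prop) _ _)
      (Continuous.intervalIntegrable (by fun_prop) _ _)]
    congr 1; ext x; ring
  have h3 : ∫ x in (-R)..R, cutoff R x * v x ^ 2 ≤ E :=
    (integral_cutoff_mul_le hR (by fun_prop) (fun x => sq_nonneg _) hi).trans hE
  have h4 : (m / E) ^ 2 * ∫ x in (-R)..R, cutoff R x * v x ^ 2 ≤ (m / E) ^ 2 * E := by gcongr
  have h5 : m ^ 2 / E = 2 * (m / E) * m - (m / E) ^ 2 * E := by field_simp; ring
  linarith

theorem cutoffDeriv_mul_cube_le {R U a p : ℝ} (hR : 0 < R) (ha : |a| ≤ U) (x : ℝ) :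
    cutoffDeriv R x * (a * p ^ 3)
      ≤ 8 / R * (cutoff R x * p ^ 4) + U ^ 2 / (2 * R) * p ^ 2 := by
  have h1 : cutoffDeriv R x ^ 2 * p ^ 4 ≤ (4 / R) ^ 2 * cutoff R x * p ^ 4 := by
    gcongr; exact cutoffDeriv_sq_le hR x
  have h2 : a ^ 2 * p ^ 2 ≤ U ^ 2 * p ^ 2 := by
    exact mul_le_mul_of_nonneg_right (sq_le_sq' (abs_le.1 ha).1 (abs_le.1 ha).2) (sq_nonneg _)
  have h3 : cutoffDeriv R x * (a * p ^ 3)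
      ≤ R / 2 * (cutoffDeriv R x ^ 2 * p ^ 4) + a ^ 2 * p ^ 2 / (2 * R) := by
    rw [show R / 2 * (cutoffDeriv R x ^ 2 * p ^ 4) + a ^ 2 * p ^ 2 / (2 * R)
      = ((R * (cutoffDeriv R x * p ^ 2)) ^ 2 + (a * p) ^ 2) / (2 * R) by field_simp,
      le_div_iff₀ (by positivity)]
    nlinarith [sq_nonneg (R * (cutoffDeriv R x * p ^ 2) - a * p)]
  calc _ ≤ _ := h3
    _ ≤ R / 2 * ((4 / R) ^ 2 * cutoff R x * p ^ 4) + U ^ 2 * p ^ 2 / (2 * R) := by gcongr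
    _ = _ := by field_simp; ring

namespace R2CHSolution

variable {A Ω T M : ℝ} {u ρ : ℝ → ℝ → ℝ} (hsol : R2CHSolution A 0 1 Ω T u ρ)

include hsol

theorem continuousOn_localCubic (R : ℝ) : ContinuousOn
    (fun t => ∫ x in (-R)..R, cutoff R x * deriv (u t) x ^ 3) (Ico 0 T) := by
  refine continuousOn_intervalIntegral_param
    (F := fun t x => cutoff R x * deriv (u t) x ^ 3) ?_ _ _
  have h3 := continuous_cutoff R
  exact ContinuousOn.mul (by fun_prop) (hsol.continuousOn_ux.pow 3)

theorem hasDerivAt_localCubic (R : ℝ) {t : ℝ} (ht : t ∈ Ioo 0 T) :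
    HasDerivAt (fun t => ∫ x in (-R)..R, cutoff R x * deriv (u t) x ^ 3)
      (∫ x in (-R)..R, cutoff R x * (3 * deriv (u t) x ^ 2 * mixedDeriv T u t x)) t := by
  have c3 := continuous_cutoff R
  have c1 := hsol.continuousOn_ux.mono
    (prod_mono (Ioo_subset_Ico_self (a := (0 : ℝ)) (b := T)) (subset_refl univ))
  refine hasDerivAt_intervalIntegral_param (s := Ioo 0 T)
    (F := fun t x => cutoff R x * deriv (u t) x ^ 3)
    (F' := fun t x => cutoff R x * (3 * deriv (u t) x ^ 2 * mixedDeriv T u t x))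
    isOpen_Ioo ?_ ?_ ?_ ht (-R) R
  · intro s hs
    have := (hsol.contDiff_ux (Ioo_subset_Ico_self hs)).continuous
    fun_prop
  · exact ContinuousOn.mul (by fun_prop) (((c1.pow 2).const_mul 3).mul hsol.continuousOn_mixedDeriv)
  · intro s hs x
    exact (((hsol.hasDerivAt_time_ux hs x).fun_pow 3).const_mul _).congr_deriv (by norm_num)

theorem integrable_ux_cube {t : ℝ} (ht : t ∈ Ico 0 T) :
    Integrable fun x => deriv (u t) x ^ 3 := by
  have hc := (hsol.contDiff_ux ht).continuous
  obtain ⟨C, hC⟩ := (ZeroAtInftyContinuousMap.isBounded_range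
    (⟨⟨deriv (u t), hc⟩, hsol.ux_decay t ht⟩ : ZeroAtInftyContinuousMap ℝ ℝ)).exists_norm_le
  refine ((hsol.ux_L2 t ht).bdd_mul hc.aestronglyMeasurable
    (ae_of_all _ fun x => hC _ (mem_range_self x))).congr (ae_of_all _ fun x => ?_)
  simp only; ring

variable (hρM : ∀ t ∈ Ico (0:ℝ) T, ∀ x : ℝ, |ρ t x| ≤ M)

include hρM

theorem integral_cutoff_mul_mixedDeriv_le (hκ : 0 < 1 - 2 * Ω * A) (hΩ : 0 ≤ Ω) (hM : 0 ≤ M)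
    (hE : 0 < energy Ω A u ρ 0) {t R : ℝ} (ht : t ∈ Ioo 0 T) (hR : 16 < R) :
    ∫ x in (-R)..R, cutoff R x * (3 * deriv (u t) x ^ 2 * mixedDeriv T u t x)
      ≤ -((1 / 2 - 8 / R) / energy Ω A u ρ 0)
          * (∫ x in (-R)..R, cutoff R x * deriv (u t) x ^ 3) ^ 2
        + (Nconst A Ω M (energy Ω A u ρ 0)
          + (1 + energy Ω A u ρ 0) ^ 2 / (2 * R) * energy Ω A u ρ 0) := by
  have ht' := Ioo_subset_Ico_self ht
  have hp := hsol.isProfile hρM ht'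
  have hE' : ∀ s ∈ Ioo 0 T, energy Ω A u ρ s ≤ energy Ω A u ρ 0 := fun s hs =>
    (hsol.energy_eq hρM hκ.le hΩ (Ioo_subset_Ico_self hs)).le
  have hEt := hE' t ht
  set E := energy Ω A u ρ 0
  set κ := 1 - 2 * Ω * A with hκd
  set N := Nconst A Ω M E
  have hN : 0 < N := Nconst_pos hΩ hκ hM hE
  have hR0 : 0 < R := by linarith
  have c0 := hp.cont0
  have c1 := hp.cont1
  have cr := hp.contr
  have c2 := (hsol.contDiff_uxx ht').continuous
  have cφ := continuous_cutoff R
  have cφ' := continuous_cutoffDeriv R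
  have cZ : Continuous (nonlocalZ A κ Ω (u t) (deriv (u t)) (ρ t)) :=
    continuous_iff_continuousAt.2 fun y => (hp.hasDerivAt_nonlocalZ hκ.le hΩ y).continuousAt
  set B : ℝ → ℝ := fun x => u t x ^ 2 - A * u t x + κ / 2 * (ρ t x ^ 2 - 1)
    - Ω * ρ t x ^ 2 * u t x - nonlocalZ A κ Ω (u t) (deriv (u t)) (ρ t) x with hB
  have cB : Continuous B := by fun_prop
  have hBle : ∀ x, B x ≤ N / (3 * E) := fun x =>
    (hp.sub_nonlocalZ_le hκ hEt hΩ x).trans (bound_le_Nconst hΩ hκ hE)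
  have hparts := integral_cutoff_mul_deriv hR0 (g := fun x => u t x * deriv (u t) x ^ 3)
    (g' := fun x => deriv (u t) x ^ 4 + 3 * u t x * deriv (u t) x ^ 2 * deriv (deriv (u t)) x)
    (fun x => ((hp.hasDeriv x).mul ((hsol.hasDerivAt_ux ht' x).fun_pow 3)).congr_deriv
      (by norm_num; ring)) (by fun_prop)
  have hrepr : ∫ x in (-R)..R, cutoff R x * (3 * deriv (u t) x ^ 2 * mixedDeriv T u t x)
      = ∫ x in (-R)..R, (cutoffDeriv R x * (u t x * deriv (u t) x ^ 3)
        + cutoff R x * (-(1 / 2) * deriv (u t) x ^ 4 + 3 * deriv (u t) x ^ 2 * B x)) := by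
    rw [intervalIntegral.integral_add (Continuous.intervalIntegrable (by fun_prop) _ _)
      (Continuous.intervalIntegrable (by fun_prop) _ _), ← neg_eq_iff_eq_neg.2 hparts,
      ← intervalIntegral.integral_neg,
      ← intervalIntegral.integral_add (Continuous.intervalIntegrable (by fun_prop) _ _)
      (Continuous.intervalIntegrable (by fun_prop) _ _)]
    congr 1; ext x
    have d2 := (hsol.defect_eq_zero hρM hκ.le hΩ le_rfl le_rfl hE' ht x).2
    rw [defectDeriv, flux] at d2
    simp only [hB]
    linear_combination 3 * cutoff R x * deriv (u t) x ^ 2 * d2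
  have hmono : ∫ x in (-R)..R, (cutoffDeriv R x * (u t x * deriv (u t) x ^ 3)
        + cutoff R x * (-(1 / 2) * deriv (u t) x ^ 4 + 3 * deriv (u t) x ^ 2 * B x))
      ≤ ∫ x in (-R)..R, (-(1 / 2 - 8 / R) * (cutoff R x * deriv (u t) x ^ 4)
        + ((1 + E) ^ 2 / (2 * R) + N / E) * deriv (u t) x ^ 2) := by
    refine intervalIntegral.integral_mono_on (by linarith)
      (Continuous.intervalIntegrable (by fun_prop) _ _)
      (Continuous.intervalIntegrable (by fun_prop) _ _) fun x _ => ?_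
    have h1 := cutoffDeriv_mul_cube_le (p := deriv (u t) x) hR0
      (hp.abs_le_one_add hκ.le hEt x) x
    have h2 : cutoff R x * (3 * deriv (u t) x ^ 2 * B x) ≤ N / E * deriv (u t) x ^ 2 :=
      calc _ ≤ cutoff R x * (3 * deriv (u t) x ^ 2 * (N / (3 * E))) :=
            mul_le_mul_of_nonneg_left (mul_le_mul_of_nonneg_left (hBle x) (by positivity))
              (cutoff_nonneg R x)
        _ ≤ 1 * (3 * deriv (u t) x ^ 2 * (N / (3 * E))) := by
            gcongr; exact cutoff_le_one R x
        _ = _ := by field_simp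
    linarith
  have hux := hp.integral_deriv_sq_le hκ.le hEt
  have hux' : ∫ x in (-R)..R, deriv (u t) x ^ 2 ≤ E :=
    (intervalIntegral_le_integral (by linarith) (fun x => sq_nonneg _) hp.int1).trans hux
  have hsq := sq_integral_cutoff_mul_cube_le c1 hp.int1 hux hE hR0
  have hcoef : 0 ≤ 1 / 2 - 8 / R := by
    rw [sub_nonneg, div_le_div_iff₀ hR0 two_pos]; linarith
  refine (hrepr.le.trans hmono).trans ?_
  rw [intervalIntegral.integral_add (Continuous.intervalIntegrable (by fun_prop) _ _)
    (Continuous.intervalIntegrable (by fun_prop) _ _), intervalIntegral.integral_const_mul,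
    intervalIntegral.integral_const_mul]
  have e1 := mul_le_mul_of_nonneg_left hsq hcoef
  have e2 : ((1 + E) ^ 2 / (2 * R) + N / E) * ∫ x in (-R)..R, deriv (u t) x ^ 2
      ≤ ((1 + E) ^ 2 / (2 * R) + N / E) * E := by gcongr
  have e3 : ((1 + E) ^ 2 / (2 * R) + N / E) * E = N + (1 + E) ^ 2 / (2 * R) * E := by
    field_simp
    ring
  rw [e3] at e2
  have e4 : (1 / 2 - 8 / R) * ((∫ x in (-R)..R, cutoff R x * deriv (u t) x ^ 3) ^ 2 / E)
      = (1 / 2 - 8 / R) / E * (∫ x in (-R)..R, cutoff R x * deriv (u t) x ^ 3) ^ 2 := by ring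
  rw [e4] at e1
  linarith

/-- The lifespan bound obtained from the cutoff at scale `R`. -/
theorem lifespan_le_local (hκ : 0 < 1 - 2 * Ω * A) (hΩ : 0 ≤ Ω) (hM : 0 ≤ M)
    (hE : 0 < energy Ω A u ρ 0) {R k a : ℝ} (hR : 16 < R)
    (hk : k = (1 / 2 - 8 / R) / energy Ω A u ρ 0)
    (ha : a = √((Nconst A Ω M (energy Ω A u ρ 0)
          + (1 + energy Ω A u ρ 0) ^ 2 / (2 * R) * energy Ω A u ρ 0) / k))
    (h0 : ∫ x in (-R)..R, cutoff R x * deriv (u 0) x ^ 3 < -a) :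
    T ≤ 1 / (2 * a * k) * log (((∫ x in (-R)..R, cutoff R x * deriv (u 0) x ^ 3) - a)
      / ((∫ x in (-R)..R, cutoff R x * deriv (u 0) x ^ 3) + a)) := by
  have hR0 : 0 < R := by linarith
  have hk0 : 0 < k := by
    have : 8 / R < 1 / 2 := by rw [div_lt_div_iff₀ hR0 two_pos]; linarith
    rw [hk]; exact div_pos (by linarith) hE
  have hN := Nconst_pos hΩ hκ hM hE
  have harg : 0 < (Nconst A Ω M (energy Ω A u ρ 0)
          + (1 + energy Ω A u ρ 0) ^ 2 / (2 * R) * energy Ω A u ρ 0) / k := by positivity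
  have ha0 : 0 < a := by rw [ha]; exact sqrt_pos.2 harg
  refine riccati_lifespan_le hk0 ha0 (hsol.continuousOn_localCubic R)
    (fun t ht => hsol.hasDerivAt_localCubic R ht) (fun t ht => ?_) h0
  have hsq : k * a ^ 2 = Nconst A Ω M (energy Ω A u ρ 0)
      + (1 + energy Ω A u ρ 0) ^ 2 / (2 * R) * energy Ω A u ρ 0 := by
    rw [ha, sq_sqrt harg.le]; field_simp
  have := hsol.integral_cutoff_mul_mixedDeriv_le hρM hκ hΩ hM hE ht hR
  rw [← hsq, ← hk] at this
  linarith

end R2CHSolution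

/-- Theorem 4.2: for `σ = 1`, `μ = 0`, if `‖ρ(t,·)‖_{L^∞} ≤ M̄` on `[0,T)` and
`∫ (∂ₓu₀)³ dx < -√(2E(0)N)`, then
`T ≤ √(E(0)/(2N)) · ln((m₀ - √(2E(0)N))/(m₀ + √(2E(0)N)))`. -/
theorem theorem_4_2 {A Ω T M : ℝ} {u ρ : ℝ → ℝ → ℝ}
    (hΩ : 0 ≤ Ω) (hΩA : 0 < 1 - 2 * Ω * A)
    (hsol : R2CHSolution A 0 1 Ω T u ρ)
    (hM : 0 ≤ M) (hρM : ∀ t ∈ Ico (0:ℝ) T, ∀ x : ℝ, |ρ t x| ≤ M)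
    (hE : 0 < energy Ω A u ρ 0)
    (hm0 : (∫ x : ℝ, (deriv (u 0) x) ^ 3) <
      -Real.sqrt (2 * energy Ω A u ρ 0 * Nconst A Ω M (energy Ω A u ρ 0))) :
    T ≤ Real.sqrt (energy Ω A u ρ 0 / (2 * Nconst A Ω M (energy Ω A u ρ 0))) *
      Real.log
        (((∫ x : ℝ, (deriv (u 0) x) ^ 3)
            - Real.sqrt (2 * energy Ω A u ρ 0 * Nconst A Ω M (energy Ω A u ρ 0)))
          / ((∫ x : ℝ, (deriv (u 0) x) ^ 3)
            + Real.sqrt (2 * energy Ω A u ρ 0 * Nconst A Ω M (energy Ω A u ρ 0)))) := by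
  set E := energy Ω A u ρ 0 with hEd
  set N := Nconst A Ω M E with hNd
  have hN : 0 < N := Nconst_pos hΩ hΩA hM hE
  set m := ∫ x : ℝ, (deriv (u 0) x) ^ 3 with hm
  set a := √(2 * E * N) with ha
  have ha0 : 0 < a := sqrt_pos.2 (by positivity)
  have hasq : a * a = 2 * E * N := mul_self_sqrt (by positivity)
  set k : ℝ → ℝ := fun R => (1 / 2 - 8 / R) / E with hk
  set b : ℝ → ℝ := fun R => √((N + (1 + E) ^ 2 / (2 * R) * E) / k R) with hb
  set y : ℝ → ℝ := fun R => ∫ x in (-R)..R, cutoff R x * deriv (u 0) x ^ 3 with hy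
  have hklim : Tendsto k atTop (𝓝 (1 / (2 * E))) := by
    have := ((tendsto_id.const_div_atTop (8 : ℝ)).const_sub (1 / 2)).div_const E
    rwa [show ((1 : ℝ) / 2 - 0) / E = 1 / (2 * E) by field_simp; ring] at this
  have hblim : Tendsto b atTop (𝓝 a) := by
    have h1 : Tendsto (fun R : ℝ => (1 + E) ^ 2 / (2 * R)) atTop (𝓝 0) :=
      (tendsto_id.const_mul_atTop two_pos).const_div_atTop _
    have h2 := (((h1.mul_const E).const_add N).div hklim (by positivity)).sqrt
    rwa [show (N + 0 * E) / (1 / (2 * E)) = 2 * E * N by field_simp; ring] at h2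
  have hylim : Tendsto y atTop (𝓝 m) :=
    tendsto_integral_cutoff_mul (hsol.integrable_ux_cube ⟨le_rfl, hsol.T_pos⟩)
  have hneg : m + a < 0 := by linarith
  have hlim : Tendsto (fun R => 1 / (2 * b R * k R) * log ((y R - b R) / (y R + b R))) atTop
      (𝓝 (1 / (2 * a * (1 / (2 * E))) * log ((m - a) / (m + a)))) := by
    refine ((tendsto_const_nhds (x := (1 : ℝ))).div ((hblim.const_mul 2).mul hklim)
      (by positivity)).mul
      (((hylim.sub hblim).div (hylim.add hblim) hneg.ne).log ?_)
    exact div_ne_zero (by linarith) hneg.ne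
  have hfac : √(E / (2 * N)) = 1 / (2 * a * (1 / (2 * E))) := by
    rw [sqrt_eq_iff_mul_self_eq (by positivity) (by positivity)]
    field_simp
    linear_combination hasq
  rw [hfac]
  refine ge_of_tendsto hlim ?_
  filter_upwards [eventually_gt_atTop 16, hylim.eventually_lt hblim.neg (by linarith)] with R hR hyR
  exact hsol.lifespan_le_local hρM hΩA hΩ hM hE hR rfl rfl hyR
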